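/- arXiv:2411.09321 — 3 statements merged into one kernel-verified Lean document; each statement's English description precedes it below -/
import Mathlib

section
/- There exists a constant δ > 0 such that the diagonal Ramsey number satisfies r(k) ≤ (4-δ)^k for all integers k ≥ 2. Concretely, there exists k₀ such that r(k) ≤ 3.993^k for all k ≥ k₀. -/
/-- A coloring `c` of the complete graph on `Fin N` contains a monochromatic clique
on `k` vertices. -/
def HasMonoClique (N k : ℕ) (c : Fin N → Fin N → Bool) : Prop :=
  ∃ (S : Finset (Fin N)) (b : Bool), S.card = k ∧
    ∀ v ∈ S, ∀ w ∈ S, v ≠ w → c v w = b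

/-- The diagonal Ramsey number `r(k)`: the least `N` such that every symmetric
two-coloring of the edges of `K_N` contains a monochromatic `K_k`. -/
noncomputable def ramsey (k : ℕ) : ℕ :=
  sInf {N | ∀ c : Fin N → Fin N → Bool, (∀ v w, c v w = c w v) → HasMonoClique N k c}


namespace RamseyAux

open Finset

variable {V : Type*} [DecidableEq V]

/-- `nb c b x S` is the set of vertices `w ≠ x` of `S` joined to `x` in color `b`. -/
def nb (c : V → V → Bool) (b : Bool) (x : V) (S : Finset V) : Finset V :=
  S.filter (fun w => w ≠ x ∧ c x w = b)

/-- `S` contains a clique of color `b` and size `k`. -/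
def Clq (c : V → V → Bool) (b : Bool) (S : Finset V) (k : ℕ) : Prop :=
  ∃ T : Finset V, T ⊆ S ∧ T.card = k ∧ ∀ v ∈ T, ∀ w ∈ T, v ≠ w → c v w = b

theorem clq_zero (c : V → V → Bool) (b : Bool) (S : Finset V) : Clq c b S 0 :=
  ⟨∅, by simp, by simp, by simp⟩

theorem Clq.mono {c : V → V → Bool} {b : Bool} {S Stwo : Finset V} {k : ℕ}
    (h : Clq c b S k) (hs : S ⊆ Stwo) : Clq c b Stwo k := by
  obtain ⟨T, h1, h2, h3⟩ := h
  exact ⟨T, h1.trans hs, h2, h3⟩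

theorem nb_subset (c : V → V → Bool) (b : Bool) (x : V) (S : Finset V) : nb c b x S ⊆ S :=
  filter_subset _ _

theorem nb_union (c : V → V → Bool) (b : Bool) (x : V) (S T : Finset V) :
    nb c b x S ∪ nb c b x T = nb c b x (S ∪ T) := by
  unfold nb; rw [filter_union]

theorem Clq.cons {c : V → V → Bool} (hc : ∀ v w, c v w = c w v) {b : Bool} {S : Finset V}
    {k : ℕ} {x : V} (hx : x ∈ S) (h : Clq c b (nb c b x S) k) : Clq c b S (k + 1) := by
  obtain ⟨T, h1, h2, h3⟩ := h
  have hT : ∀ w ∈ T, w ∈ S ∧ w ≠ x ∧ c x w = b := by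
    intro w hw
    simpa [nb] using h1 hw
  have hxT : x ∉ T := fun hxtwo => (hT x hxtwo).2.1 rfl
  refine ⟨insert x T, ?_, ?_, ?_⟩
  · intro w hw
    rcases mem_insert.1 hw with rfl | hw
    · exact hx
    · exact (hT w hw).1
  · rw [card_insert_of_notMem hxT, h2]
  · intro v hv w hw hvw
    rcases mem_insert.1 hv with rfl | hv
    · rcases mem_insert.1 hw with rfl | hw
      · exact absurd rfl hvw
      · exact (hT w hw).2.2
    · rcases mem_insert.1 hw with hwx | hw
      · rw [hwx, hc]; exact (hT v hv).2.2
      · exact h3 v hv w hw hvw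

theorem sum_split (c : V → V → Bool) {x : V} {S : Finset V} (hx : x ∈ S) (f : V → ℝ) :
    ∑ w ∈ S, f w = f x + ∑ w ∈ nb c true x S, f w + ∑ w ∈ nb c false x S, f w := by
  have h1 : S = insert x (nb c true x S ∪ nb c false x S) := by
    ext w
    simp only [nb, mem_insert, mem_union, mem_filter]
    by_cases h : w = x
    · subst h; simp [hx]
    · cases c x w <;> simp [h]
  have h2 : x ∉ nb c true x S ∪ nb c false x S := by simp [nb]
  have h3 : Disjoint (nb c true x S) (nb c false x S) := by
    rw [Finset.disjoint_left]
    intro w h htwo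
    simp only [nb, mem_filter] at h htwo
    simp [h.2.2] at htwo
  conv_lhs => rw [h1]
  rw [sum_insert h2, sum_union h3]; ring

theorem card_split (c : V → V → Bool) {x : V} {S : Finset V} (hx : x ∈ S) :
    (S.card : ℝ) = 1 + (nb c true x S).card + (nb c false x S).card := by
  have := sum_split c hx (fun _ => (1 : ℝ))
  simpa using this

/-- Erdős–Szekeres. -/
theorem erdos_szekeres (c : V → V → Bool) (hc : ∀ v w, c v w = c w v) (a b : ℝ) (ha : 0 < a)
    (hb : 0 < b) (hab : a + b ≤ 1) : ∀ (n k l : ℕ), k + l = n → ∀ S : Finset V,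
    1 ≤ a ^ k * b ^ l * ((S.card : ℝ) + 1) → Clq c true S k ∨ Clq c false S l := by
  intro n
  induction n with
  | zero =>
    intro k l hkl S _
    obtain rfl : k = 0 := by omega
    exact Or.inl (clq_zero _ _ _)
  | succ n ih =>
    intro k l hkl S hS
    rcases k with _ | k
    · exact Or.inl (clq_zero _ _ _)
    rcases l with _ | l
    · exact Or.inr (clq_zero _ _ _)
    have hne : S.Nonempty := by
      rw [nonempty_iff_ne_empty]
      rintro rfl
      have h1 : a ^ (k + 1) < 1 := pow_lt_one₀ ha.le (by linarith) (by omega)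
      have h2 : b ^ (l + 1) ≤ 1 := pow_le_one₀ hb.le (by linarith)
      have h3 : 0 < a ^ (k + 1) := by positivity
      simp at hS
      nlinarith
    obtain ⟨x, hx⟩ := hne
    have hcard := card_split c hx
    by_cases hR : 1 ≤ a ^ k * b ^ (l + 1) * (((nb c true x S).card : ℝ) + 1)
    · rcases ih k (l + 1) (by omega) _ hR with h | h
      · exact Or.inl (h.cons hc hx)
      · exact Or.inr (h.mono (nb_subset _ _ _ _))
    by_cases hB : 1 ≤ a ^ (k + 1) * b ^ l * (((nb c false x S).card : ℝ) + 1)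
    · rcases ih (k + 1) l (by omega) _ hB with h | h
      · exact Or.inl (h.mono (nb_subset _ _ _ _))
      · exact Or.inr (h.cons hc hx)
    exfalso
    push Not at hR hB
    rw [hcard] at hS
    have e : a ^ (k + 1) * b ^ (l + 1) *
        (1 + ((nb c true x S).card : ℝ) + ((nb c false x S).card : ℝ) + 1)
        = a * (a ^ k * b ^ (l + 1) * (((nb c true x S).card : ℝ) + 1))
          + b * (a ^ (k + 1) * b ^ l * (((nb c false x S).card : ℝ) + 1)) := by ring
    rw [e] at hS
    nlinarith

/-- The excess of red edges between `X` and `Y` over density `p`. -/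
noncomputable def exc (c : V → V → Bool) (p : ℝ) (X Y : Finset V) : ℝ :=
  ∑ x ∈ X, (((nb c true x Y).card : ℝ) - p * Y.card)

theorem averaging (c : V → V → Bool) (p κ K : ℝ) (hp : 0 ≤ p) (hκ : 0 ≤ κ)
    (hκ1 : κ ≤ 1) (hK : 0 < K) (hKκ : 1 ≤ κ * K) (X Y : Finset V) (hE : 0 < exc c p X Y)
    (hEK : K * Y.card ≤ exc c p X Y) (hY : 0 < Y.card) :
    ∃ x ∈ X, (1 - κ) * exc c p X Y * (p * Y.card + 3 * (nb c true x Y).card) / 4 ≤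
      Y.card * (exc c p (nb c true x X) (nb c true x Y) +
        exc c p (nb c false x X) (nb c true x Y)) := by
  obtain ⟨E, hEdef⟩ : ∃ E, E = exc c p X Y := ⟨_, rfl⟩
  rw [← hEdef] at hE hEK ⊢
  have hYr : (0 : ℝ) < Y.card := by exact_mod_cast hY
  obtain ⟨D, hD⟩ : ∃ D : ℝ, D = ∑ x ∈ X, ((nb c true x Y).card : ℝ) := ⟨_, rfl⟩
  have hED : E = D - p * X.card * Y.card := by
    rw [hEdef, exc, sum_sub_distrib, hD]; simp; ring
  have hDp : p * X.card * Y.card ≤ D := by linarith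
  have hD0 : 0 ≤ D := by rw [hD]; positivity
  let g : V → V → ℝ := fun x y => if y ≠ x ∧ c x y = true then 1 else 0
  have hg : ∀ x (Z : Finset V), ((nb c true x Z).card : ℝ) = ∑ y ∈ Z, g x y := by
    intro x Z; simp [nb, g]
  have hg2 : ∀ x xtwo (Z : Finset V),
      ((nb c true xtwo (nb c true x Z)).card : ℝ) = ∑ y ∈ Z, g x y * g xtwo y := by
    intro x xtwo Z
    rw [hg, nb, sum_filter]
    refine sum_congr rfl fun y _ => ?_
    by_cases h : y ≠ x ∧ c x y = true <;> simp [g, h]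
  have hDy : D = ∑ y ∈ Y, ∑ x ∈ X, g x y := by
    rw [hD, sum_comm]; exact sum_congr rfl fun x _ => hg x Y
  have hcs : D ^ 2 ≤ Y.card * ∑ y ∈ Y, (∑ x ∈ X, g x y) ^ 2 := by
    rw [hDy]; exact sq_sum_le_card_mul_sum_sq
  have hfull : ∑ x ∈ X, exc c p X (nb c true x Y) =
      (∑ y ∈ Y, (∑ x ∈ X, g x y) ^ 2) - p * X.card * D := by
    have h1 : ∀ x ∈ X, exc c p X (nb c true x Y) =
        (∑ xtwo ∈ X, ∑ y ∈ Y, g x y * g xtwo y) - p * X.card * (nb c true x Y).card := by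
      intro x _
      rw [exc, sum_sub_distrib]
      simp only [hg2, sum_const, nsmul_eq_mul]
      ring
    rw [sum_congr rfl h1, sum_sub_distrib, ← mul_sum, ← hD]
    congr 1
    simp only [sq, sum_mul_sum]
    have hR : ∑ y ∈ Y, ∑ x ∈ X, ∑ xtwo ∈ X, g x y * g xtwo y =
        ∑ x ∈ X, ∑ y ∈ Y, ∑ xtwo ∈ X, g x y * g xtwo y := sum_comm
    rw [hR]
    exact sum_congr rfl fun x _ => sum_comm
  have hsplit : ∀ x ∈ X, exc c p X (nb c true x Y) ≤
      exc c p (nb c true x X) (nb c true x Y) +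
        exc c p (nb c false x X) (nb c true x Y) + (nb c true x Y).card := by
    intro x hx
    have h := sum_split c hx
      (fun w => (((nb c true w (nb c true x Y)).card : ℝ) - p * (nb c true x Y).card))
    have h2 : ((nb c true x (nb c true x Y)).card : ℝ) ≤ (nb c true x Y).card := by
      exact_mod_cast card_le_card (nb_subset _ _ _ _)
    have h3 : 0 ≤ p * ((nb c true x Y).card : ℝ) := by positivity
    simp only [exc]
    rw [h]
    linarith
  by_contra hcon
  push Not at hcon
  have hXne : X.Nonempty := by
    rw [nonempty_iff_ne_empty]; rintro rfl
    rw [hEdef] at hE; simp [exc] at hE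
  have hsum := sum_lt_sum_of_nonempty hXne hcon
  have hs2 := sum_le_sum hsplit
  rw [hfull, sum_add_distrib, ← hD] at hs2
  rw [← mul_sum] at hsum
  have hR : ∑ x ∈ X, (1 - κ) * E * (p * Y.card + 3 * (nb c true x Y).card) / 4
      = (1 - κ) * E * (p * X.card * Y.card + 3 * D) / 4 := by
    rw [← sum_div, ← mul_sum, sum_add_distrib, ← mul_sum, ← mul_sum, ← hD, sum_const,
      nsmul_eq_mul]; ring
  rw [hR] at hsum
  have h5 : (1 - κ) * E * (p * X.card * Y.card + 3 * D) / 4 ≤ (1 - κ) * E * D := by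
    have : 0 ≤ (1 - κ) * E := mul_nonneg (by linarith) hE.le
    nlinarith
  have h6 : (Y.card : ℝ) ≤ κ * E := by nlinarith
  have h7 : D * Y.card ≤ D * (κ * E) := mul_le_mul_of_nonneg_left h6 hD0
  have h8 := mul_le_mul_of_nonneg_left hs2 hYr.le
  have h9 : D * E = D ^ 2 - p * X.card * Y.card * D := by rw [hED]; ring
  nlinarith

theorem amgm4 (p y : ℝ) (hp : 0 ≤ p) (hy : 0 ≤ y) : p * y ^ 3 ≤ ((p + 3 * y) / 4) ^ 4 := by
  have h : ((p + 3 * y) / 4) ^ 4 - p * y ^ 3 =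
      (p - y) ^ 2 * (p ^ 2 + 14 * p * y + 81 * y ^ 2) / 256 := by ring
  have : 0 ≤ (p - y) ^ 2 * (p ^ 2 + 14 * p * y + 81 * y ^ 2) / 256 := by positivity
  linarith

theorem step_ineq (p t E Etwo Yc Ytwo A : ℝ) (hp : 0 ≤ p) (ht : 0 ≤ t) (hE : 0 < E) (hY : 0 < Yc)
    (hYtwo : 0 ≤ Ytwo) (hA : 0 ≤ A)
    (h : t * E * (p * Yc + 3 * Ytwo) / 4 ≤ Yc * Etwo) (K : ℝ)
    (hK : K * Yc ^ 3 ≤ E ^ 4 * ((t ^ 4 * p) * A)) : K * Ytwo ^ 3 ≤ Etwo ^ 4 * A := by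
  have h1 := amgm4 (p * Yc) Ytwo (by positivity) hYtwo
  have h2 : (t * E * (p * Yc + 3 * Ytwo) / 4) ^ 4 ≤ (Yc * Etwo) ^ 4 :=
    pow_le_pow_left₀ (by positivity) h 4
  have h3 : (t * E) ^ 4 * (p * Yc * Ytwo ^ 3) ≤ (Yc * Etwo) ^ 4 := by
    refine le_trans ?_ h2
    have := mul_le_mul_of_nonneg_left h1 (show 0 ≤ (t * E) ^ 4 by positivity)
    refine this.trans (le_of_eq (by ring))
  have h4 := mul_le_mul_of_nonneg_right h3 hA
  have h5 := mul_le_mul_of_nonneg_right hK (show 0 ≤ Yc * Ytwo ^ 3 by positivity)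
  have h6 : Yc ^ 4 * (K * Ytwo ^ 3) ≤ Yc ^ 4 * (Etwo ^ 4 * A) := by nlinarith
  exact le_of_mul_le_mul_left h6 (by positivity)

theorem book (c : V → V → Bool) (hc : ∀ v w, c v w = c w v) (p s t κ K a b : ℝ) (hp : 0 < p)
    (hs : 0 < s) (ht : 0 < t) (hκ : 0 ≤ κ) (hst : s + t = 1 - κ) (hK : 0 < K)
    (hKκ : 1 ≤ κ * K) (ha : a = s ^ 4 * p) (hb : b = t ^ 4 * p) (ha1 : a < 1) (hb1 : b ≤ 1)
    (L : ℕ) : ∀ (n k l : ℕ), k + l = n → ∀ X Y : Finset V, 0 < exc c p X Y →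
    K ^ 4 * (Y.card : ℝ) ^ 3 ≤ (exc c p X Y) ^ 4 * (a ^ k * b ^ l * (1 - a) ^ L) →
    Clq c true (X ∪ Y) k ∨ Clq c false X l ∨ Clq c false Y L := by
  have ha0 : 0 < a := by rw [ha]; positivity
  have hb0 : 0 < b := by rw [hb]; positivity
  have h1a : 0 < 1 - a := by linarith
  intro n
  induction n with
  | zero =>
    intro k l hkl X Y _ _
    obtain rfl : k = 0 := by omega
    exact Or.inl (clq_zero _ _ _)
  | succ n ih =>
    intro k l hkl X Y hE hV
    rcases k with _ | k
    · exact Or.inl (clq_zero _ _ _)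
    rcases l with _ | l
    · exact Or.inr (Or.inl (clq_zero _ _ _))
    have hY : 0 < Y.card := by
      rw [card_pos, nonempty_iff_ne_empty]
      rintro rfl
      simp [exc, nb] at hE
    have hYr : (0 : ℝ) < Y.card := by exact_mod_cast hY
    by_cases hEK : K * Y.card ≤ exc c p X Y
    · obtain ⟨x, hx, hav⟩ := averaging c p κ K hp.le hκ (by linarith) hK hKκ X Y hE hEK hY
      set E := exc c p X Y
      set y : ℝ := ((nb c true x Y).card : ℝ) with hy
      have hy0 : 0 ≤ y := by positivity
      have hpos : 0 < p * (Y.card : ℝ) + 3 * y := by positivity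
      by_cases hR : s * E * (p * Y.card + 3 * y) / 4 ≤
          Y.card * exc c p (nb c true x X) (nb c true x Y)
      · have hER : 0 < exc c p (nb c true x X) (nb c true x Y) := by
          have : 0 < s * E * (p * Y.card + 3 * y) / 4 := by positivity
          exact pos_of_mul_pos_right (this.trans_le hR) hYr.le
        rcases ih k (l + 1) (by omega) _ _ hER
          (step_ineq p s E _ Y.card y _ hp.le hs.le hE hYr hy0 (by positivity) hR _
            (by rw [← ha]; refine hV.trans (le_of_eq (by ring)))) with h | h | h
        · rw [nb_union] at h
          exact Or.inl (h.cons hc (mem_union_left _ hx))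
        · exact Or.inr (Or.inl (h.mono (nb_subset _ _ _ _)))
        · exact Or.inr (Or.inr (h.mono (nb_subset _ _ _ _)))
      · have hB : t * E * (p * Y.card + 3 * y) / 4 ≤
            Y.card * exc c p (nb c false x X) (nb c true x Y) := by
          push Not at hR
          rw [← hst] at hav
          linarith
        have hEB : 0 < exc c p (nb c false x X) (nb c true x Y) := by
          have : 0 < t * E * (p * Y.card + 3 * y) / 4 := by positivity
          exact pos_of_mul_pos_right (this.trans_le hB) hYr.le
        rcases ih (k + 1) l (by omega) _ _ hEB
          (step_ineq p t E _ Y.card y _ hp.le ht.le hE hYr hy0 (by positivity) hB _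
            (by rw [← hb]; refine hV.trans (le_of_eq (by ring)))) with h | h | h
        · exact Or.inl (h.mono (union_subset_union (nb_subset _ _ _ _) (nb_subset _ _ _ _)))
        · exact Or.inr (Or.inl (h.cons hc hx))
        · exact Or.inr (Or.inr (h.mono (nb_subset _ _ _ _)))
    · push Not at hEK
      have h4 : (exc c p X Y) ^ 4 ≤ (K * Y.card) ^ 4 := pow_le_pow_left₀ hE.le hEK.le 4
      have hA : 0 < a ^ (k + 1) * b ^ (l + 1) * (1 - a) ^ L := by positivity
      have h5 := hV.trans (mul_le_mul_of_nonneg_right h4 hA.le)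
      have h6 : (K ^ 4 * (Y.card : ℝ) ^ 3) * 1 ≤ (K ^ 4 * (Y.card : ℝ) ^ 3) *
          (Y.card * (a ^ (k + 1) * b ^ (l + 1) * (1 - a) ^ L)) := by
        refine le_trans (by linarith) (h5.trans (le_of_eq (by ring)))
      have h7 := le_of_mul_le_mul_left h6 (by positivity)
      have h8 : b ^ (l + 1) ≤ 1 := pow_le_one₀ hb0.le hb1
      have h9 : 1 ≤ a ^ (k + 1) * (1 - a) ^ L * ((Y.card : ℝ) + 1) := by
        have hq : 0 < a ^ (k + 1) * (1 - a) ^ L := by positivity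
        have h10 : (Y.card * (a ^ (k + 1) * (1 - a) ^ L)) * b ^ (l + 1) ≤
          (Y.card * (a ^ (k + 1) * (1 - a) ^ L)) * 1 :=
          mul_le_mul_of_nonneg_left h8 (by positivity)
        nlinarith
      rcases erdos_szekeres c hc a (1 - a) ha0 h1a (by linarith) _ (k + 1) L rfl Y h9 with h | h
      · exact Or.inl (h.mono subset_union_right)
      · exact Or.inr (Or.inr h)

/-- `R(k,l) ≤ 10^6 u^{-k} v^{-l}` with `u = 0.5627`, `v = 0.4475`. -/
theorem main_bound (c : V → V → Bool) (hc : ∀ v w, c v w = c w v) (k : ℕ) :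
    ∀ (l : ℕ) (S : Finset V),
    (1000000 : ℝ) ≤ S.card * ((0.5627 : ℝ) ^ k * (0.4475 : ℝ) ^ l) →
    Clq c true S k ∨ Clq c false S l := by
  intro l
  induction l with
  | zero => intro S _; exact Or.inr (clq_zero _ _ _)
  | succ l ih =>
    intro S hS
    by_cases hblue : ∃ x ∈ S, (0.4475 : ℝ) * S.card ≤ (nb c false x S).card
    · obtain ⟨x, hx, hb⟩ := hblue
      have : (1000000 : ℝ) ≤ (nb c false x S).card * ((0.5627 : ℝ) ^ k * (0.4475 : ℝ) ^ l) := by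
        refine hS.trans ?_
        have := mul_le_mul_of_nonneg_right hb
          (show (0 : ℝ) ≤ (0.5627 : ℝ) ^ k * (0.4475 : ℝ) ^ l by positivity)
        refine le_trans (le_of_eq (by ring)) this
      rcases ih _ this with h | h
      · exact Or.inl (h.mono (nb_subset _ _ _ _))
      · exact Or.inr (h.cons hc hx)
    · push Not at hblue
      set n : ℝ := (S.card : ℝ) with hn
      set q : ℝ := (0.5627 : ℝ) ^ k * (0.4475 : ℝ) ^ (l + 1) with hq
      have hq0 : 0 < q := by positivity
      have hq1 : q ≤ 1 := mul_le_one₀ (pow_le_one₀ (by norm_num) (by norm_num)) (by positivity)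
        (pow_le_one₀ (by norm_num) (by norm_num))
      have hn0 : 0 ≤ n := by positivity
      have hnbig : 1000000 ≤ n := by nlinarith
      have hE : n ^ 2 / 800 ≤ exc c 0.55 S S := by
        have h1 : ∀ x ∈ S, n / 800 ≤ ((nb c true x S).card : ℝ) - 0.55 * S.card := by
          intro x hx
          have h2 := card_split c hx
          have h3 := hblue x hx
          rw [← hn] at h2 ⊢
          linarith
        have h2 := sum_le_sum h1
        rw [sum_const, nsmul_eq_mul, ← hn] at h2
        refine le_trans (le_of_eq (by ring)) h2
      have hEpos : 0 < exc c 0.55 S S := lt_of_lt_of_le (by positivity) hE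
      have hbook := book c hc 0.55 0.566 0.432 0.002 500 (0.566 ^ 4 * 0.55) (0.432 ^ 4 * 0.55)
        (by norm_num) (by norm_num) (by norm_num) (by norm_num) (by norm_num) (by norm_num)
        (by norm_num) rfl rfl (by norm_num) (by norm_num) (l + 1) _ k (l + 1) rfl S S hEpos ?_
      · rcases hbook with h | h | h
        · rw [union_self] at h; exact Or.inl h
        · exact Or.inr h
        · exact Or.inr h
      · rw [← hn]
        have e1 : q ^ 5 ≤ ((0.566 : ℝ) ^ 4 * 0.55) ^ k * ((0.432 : ℝ) ^ 4 * 0.55) ^ (l + 1) *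
            (1 - (0.566 : ℝ) ^ 4 * 0.55) ^ (l + 1) := by
          have e2 : q ^ 5 = ((0.5627 : ℝ) ^ 5) ^ k * ((0.4475 : ℝ) ^ 5) ^ (l + 1) := by
            rw [hq, mul_pow, ← pow_mul, ← pow_mul, ← pow_mul, ← pow_mul, mul_comm k 5,
              mul_comm (l + 1) 5]
          rw [e2, mul_assoc, ← mul_pow]
          refine mul_le_mul (pow_le_pow_left₀ (by norm_num) (by norm_num) _)
            (pow_le_pow_left₀ (by norm_num) (by norm_num) _) (by positivity) (by positivity)
        have e3 : (n ^ 2 / 800) ^ 4 ≤ (exc c 0.55 S S) ^ 4 :=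
          pow_le_pow_left₀ (by positivity) hE 4
        have e4 : (n ^ 2 / 800) ^ 4 * q ^ 5 ≤ _ :=
          mul_le_mul e3 e1 (by positivity) (by positivity)
        refine le_trans ?_ e4
        have e5 : (1000000 : ℝ) ^ 5 ≤ (n * q) ^ 5 := pow_le_pow_left₀ (by norm_num) hS 5
        have e6 : (n ^ 2 / 800) ^ 4 * q ^ 5 = n ^ 3 * ((n * q) ^ 5 / 800 ^ 4) := by ring
        rw [e6, mul_comm]
        refine mul_le_mul_of_nonneg_left ?_ (by positivity)
        refine le_trans ?_ (div_le_div_of_nonneg_right e5 (by positivity))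
        norm_num

theorem ramsey_le_of (N k : ℕ)
    (h : ∀ c : Fin N → Fin N → Bool, (∀ v w, c v w = c w v) →
      Clq c true univ k ∨ Clq c false univ k) : ramsey k ≤ N := by
  refine Nat.sInf_le ?_
  intro c hc
  rcases h c hc with ⟨T, _, h2, h3⟩ | ⟨T, _, h2, h3⟩
  · exact ⟨T, true, h2, h3⟩
  · exact ⟨T, false, h2, h3⟩

theorem ramsey_small (k : ℕ) : (ramsey k : ℝ) ≤ 4 ^ k - 1 := by
  have h : ramsey k ≤ 4 ^ k - 1 := by
    refine ramsey_le_of _ _ fun c hc => ?_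
    refine erdos_szekeres c hc (1 / 2) (1 / 2) (by norm_num) (by norm_num) (by norm_num) _ k k rfl
      univ ?_
    have h1 : 1 ≤ 4 ^ k := Nat.one_le_pow _ _ (by norm_num)
    rw [card_univ, Fintype.card_fin, ← mul_pow, Nat.cast_sub h1]
    push_cast
    rw [sub_add_cancel, ← mul_pow]
    norm_num
  have h1 : 1 ≤ 4 ^ k := Nat.one_le_pow _ _ (by norm_num)
  have h2 : (ramsey k : ℝ) ≤ ((4 ^ k - 1 : ℕ) : ℝ) := by exact_mod_cast h
  rw [Nat.cast_sub h1] at h2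
  push_cast at h2
  exact h2

theorem ramsey_large : ∃ k₀ : ℕ, ∀ k : ℕ, k₀ ≤ k → (ramsey k : ℝ) ≤ (3.993 : ℝ) ^ k := by
  obtain ⟨k₀, hk₀⟩ := pow_unbounded_of_one_lt (1000001 : ℝ)
    (show (1 : ℝ) < 3.993 * (0.5627 * 0.4475) by norm_num)
  refine ⟨k₀, fun k hk => ?_⟩
  have h1 : (1000001 : ℝ) ≤ (3.993 * (0.5627 * 0.4475)) ^ k :=
    hk₀.le.trans (pow_le_pow_right₀ (by norm_num) hk)
  have h2 : ramsey k ≤ ⌊(3.993 : ℝ) ^ k⌋₊ := by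
    refine ramsey_le_of _ _ fun c hc => main_bound c hc k k univ ?_
    rw [card_univ, Fintype.card_fin, ← mul_pow]
    have h3 := Nat.lt_floor_add_one ((3.993 : ℝ) ^ k)
    rw [mul_pow] at h1
    have h4 : ((0.5627 : ℝ) * 0.4475) ^ k ≤ 1 := pow_le_one₀ (by norm_num) (by norm_num)
    have h5 : 0 ≤ ((0.5627 : ℝ) * 0.4475) ^ k := by positivity
    nlinarith
  exact (Nat.cast_le.2 h2).trans (Nat.floor_le (by positivity))

end RamseyAux

/-- **Campos–Griffiths–Morris–Sahasrabudhe.** There is a constant `δ > 0` with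
`r(k) ≤ (4-δ)^k` for all `k ≥ 2`; concretely, `r(k) ≤ 3.993^k` for all sufficiently
large `k`. -/
theorem ramsey_le_four_sub_delta :
    (∃ δ : ℝ, 0 < δ ∧ ∀ k : ℕ, 2 ≤ k → (ramsey k : ℝ) ≤ (4 - δ) ^ k) ∧
      ∃ k₀ : ℕ, ∀ k : ℕ, k₀ ≤ k → (ramsey k : ℝ) ≤ (3.993 : ℝ) ^ k := by
  obtain ⟨k₀, hk₀⟩ := RamseyAux.ramsey_large
  refine ⟨⟨0.007 / ((k₀ + 1) * 4 ^ k₀), by positivity, fun k _ => ?_⟩, k₀, hk₀⟩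
  have hk0 : (0 : ℝ) ≤ k₀ := by positivity
  have h4 : (1 : ℝ) ≤ 4 ^ k₀ := one_le_pow₀ (by norm_num)
  have hden : (1 : ℝ) ≤ (k₀ + 1) * 4 ^ k₀ := by nlinarith
  have hδ : (0.007 : ℝ) / ((k₀ + 1) * 4 ^ k₀) ≤ 0.007 := div_le_self (by norm_num) hden
  rcases le_total k₀ k with hk | hk
  · exact (hk₀ k hk).trans (pow_le_pow_left₀ (by norm_num) (by linarith) k)
  · refine (RamseyAux.ramsey_small k).trans ?_
    set δ : ℝ := 0.007 / ((k₀ + 1) * 4 ^ k₀) with hδd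
    have hδ0 : 0 < δ := by rw [hδd]; positivity
    have hb := one_add_mul_le_pow (show (-2 : ℝ) ≤ -(δ / 4) by linarith) k
    have e : (4 - δ) ^ k = 4 ^ k * (1 + -(δ / 4)) ^ k := by rw [← mul_pow]; ring
    rw [e]
    have h4k : (0 : ℝ) < 4 ^ k := by positivity
    have h5 := mul_le_mul_of_nonneg_left hb h4k.le
    have h6 : (4 : ℝ) ^ k ≤ 4 ^ k₀ := pow_le_pow_right₀ (by norm_num) hk
    have h7 : (k : ℝ) ≤ k₀ + 1 := by
      have : (k : ℝ) ≤ k₀ := by exact_mod_cast hk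
      linarith
    have h8 : (k : ℝ) * 4 ^ k ≤ (k₀ + 1) * 4 ^ k₀ :=
      mul_le_mul h7 h6 h4k.le (by positivity)
    have h9 : ((k₀ + 1) * 4 ^ k₀) * δ = 0.007 := by
      rw [hδd]; field_simp
    have h10 : (k : ℝ) * 4 ^ k * δ ≤ 0.007 := h9 ▸ mul_le_mul_of_nonneg_right h8 hδ0.le
    nlinarith
end

section
/- For every ε > 0 there exists k₀ such that for all integers k ≥ k₀ and all integers ℓ with 2 ≤ ℓ ≤ k/4, the off-diagonal Ramsey number satisfies r(k,ℓ) ≤ 2^{-(2/9)ℓ + εk} · binomial(k+ℓ, ℓ). -/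
/-- A coloring `c` of the complete graph on `Fin N` (with `true` = red, `false` = blue)
contains a red clique on `k` vertices. -/
def HasRedClique (N k : ℕ) (c : Fin N → Fin N → Bool) : Prop :=
  ∃ S : Finset (Fin N), S.card = k ∧ ∀ v ∈ S, ∀ w ∈ S, v ≠ w → c v w = true

/-- A coloring `c` of the complete graph on `Fin N` contains a blue clique on `ℓ` vertices. -/
def HasBlueClique (N l : ℕ) (c : Fin N → Fin N → Bool) : Prop :=
  ∃ S : Finset (Fin N), S.card = l ∧ ∀ v ∈ S, ∀ w ∈ S, v ≠ w → c v w = false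

/-- `N` is Ramsey for the pair `(k, ℓ)`: every symmetric two-coloring of the edges of `K_N`
contains a red `K_k` or a blue `K_ℓ`. -/
def IsRamseyPair (k l N : ℕ) : Prop :=
  ∀ c : Fin N → Fin N → Bool, (∀ v w, c v w = c w v) →
    HasRedClique N k c ∨ HasBlueClique N l c

/-- The off-diagonal Ramsey number `r(k, ℓ)`: the least `N` such that every symmetric
two-coloring of the edges of `K_N` contains a red `K_k` or a blue `K_ℓ`. -/
noncomputable def ramseyOff (k l : ℕ) : ℕ := sInf {N | IsRamseyPair k l N}


/-- monochromatic clique of colour `b` and size `k` inside `S` -/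
def MCl {V : Type*} (c : V → V → Bool) (b : Bool) (k : ℕ) (S : Finset V) : Prop :=
  ∃ T ⊆ S, T.card = k ∧ ∀ v ∈ T, ∀ w ∈ T, v ≠ w → c v w = b

/-- neighbourhood of `v` in colour `b` inside `S` -/
def MN {V : Type*} [DecidableEq V] (c : V → V → Bool) (b : Bool) (v : V) (S : Finset V) : Finset V :=
  S.filter (fun w => w ≠ v ∧ c v w = b)

section comb
set_option linter.unusedSectionVars false
variable {V : Type*} [DecidableEq V] {c : V → V → Bool}

lemma MCl.mono {b : Bool} {k : ℕ} {S T : Finset V} (h : MCl c b k S) (hST : S ⊆ T) : MCl c b k T := by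
  obtain ⟨U, hU, h1, h2⟩ := h
  exact ⟨U, hU.trans hST, h1, h2⟩

lemma MCl.mono_size {b : Bool} {k l : ℕ} {S : Finset V} (h : MCl c b k S) (hST : l ≤ k) :
    MCl c b l S := by
  obtain ⟨U, hU, h1, h2⟩ := h
  obtain ⟨U', hU', h3⟩ := Finset.exists_subset_card_eq (h1 ▸ hST : l ≤ U.card)
  exact ⟨U', hU'.trans hU, h3, fun v hv w hw => h2 v (hU' hv) w (hU' hw)⟩

lemma MCl.zero (c : V → V → Bool) (b : Bool) (S : Finset V) : MCl c b 0 S :=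
  ⟨∅, by simp, by simp, by simp⟩

/-- joining two cliques -/
lemma MCl.join (hc : ∀ v w, c v w = c w v) {b : Bool} {k : ℕ} {S T X : Finset V}
    (hS : S ⊆ X) (hTX : T ⊆ X) (hcl : ∀ v ∈ S, ∀ w ∈ S, v ≠ w → c v w = b)
    (hT : ∀ z ∈ T, ∀ u ∈ S, z ≠ u ∧ c u z = b)
    (h : MCl c b k T) : MCl c b (k + S.card) X := by
  obtain ⟨U, hU, h1, h2⟩ := h
  refine ⟨U ∪ S, Finset.union_subset (hU.trans hTX) hS, ?_, ?_⟩
  · rw [Finset.card_union_of_disjoint, h1]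
    rw [Finset.disjoint_left]
    intro a ha hb
    exact (hT a (hU ha) a hb).1 rfl
  · intro v hv w hw hvw
    rw [Finset.mem_union] at hv hw
    rcases hv with hv | hv <;> rcases hw with hw | hw
    · exact h2 v hv w hw hvw
    · rw [hc]; exact (hT v (hU hv) w hw).2
    · exact (hT w (hU hw) v hv).2
    · exact hcl v hv w hw hvw

lemma MCl.cons (hc : ∀ v w, c v w = c w v) {b : Bool} {k : ℕ} {T X : Finset V} {v : V}
    (hv : v ∈ X) (hTX : T ⊆ X) (hT : ∀ z ∈ T, z ≠ v ∧ c v z = b)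
    (h : MCl c b k T) : MCl c b (k + 1) X := by
  have := MCl.join (S := {v}) hc (by simpa using hv) hTX (by simp) (by simpa using hT) h
  simpa using this

lemma MN_subset (b : Bool) (v : V) (S : Finset V) : MN c b v S ⊆ S := Finset.filter_subset _ _

lemma mem_MN {b : Bool} {v z : V} {S : Finset V} : z ∈ MN c b v S ↔ z ∈ S ∧ z ≠ v ∧ c v z = b := by
  simp [MN]

lemma MN_card_add {v : V} {S : Finset V} (hv : v ∈ S) :
    (MN c true v S).card + (MN c false v S).card + 1 = S.card := by
  rw [← Finset.card_union_of_disjoint]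
  · rw [← Finset.card_erase_add_one hv]
    congr 2
    ext z
    simp only [Finset.mem_union, mem_MN, Finset.mem_erase]
    cases c v z <;> simp [and_comm]
  · rw [Finset.disjoint_left]
    intro a ha hb
    rw [mem_MN] at ha hb
    simp_all

lemma erdos_szekeres (hc : ∀ v w, c v w = c w v) : ∀ n k l : ℕ, k + l = n → ∀ Y : Finset V,
    (k + l).choose k ≤ Y.card → MCl c true k Y ∨ MCl c false l Y := by
  intro n
  induction n with
  | zero => 
    intro k l h Y hY
    have : k = 0 := by omega
    subst this
    left; exact MCl.zero _ _ _
  | succ n ih =>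
    intro k l h Y hY
    rcases k with _ | k
    · left; exact MCl.zero _ _ _
    rcases l with _ | l
    · right; exact MCl.zero _ _ _
    have hpos : 0 < Y.card := lt_of_lt_of_le (Nat.choose_pos (by omega)) hY
    obtain ⟨v, hv⟩ := Finset.card_pos.1 hpos
    have h1 := MN_card_add (c := c) hv
    have h2 : (k + 1 + (l + 1)).choose (k + 1) = (k + (l + 1)).choose k + (k + 1 + l).choose (k + 1) := by
      have : k + 1 + (l + 1) = (k + (l + 1)) + 1 := by ring
      rw [this, Nat.choose_succ_succ]
      congr 2; ring
    by_cases hR : (k + (l + 1)).choose k ≤ (MN c true v Y).card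
    · rcases ih k (l + 1) (by omega) _ hR with h | h
      · left
        exact MCl.cons hc hv (MN_subset _ _ _) (fun z hz => (mem_MN.1 hz).2) h
      · right; exact h.mono (MN_subset _ _ _)
    · have hB : (k + 1 + l).choose (k + 1) ≤ (MN c false v Y).card := by omega
      rcases ih (k + 1) l (by omega) _ hB with h | h
      · left; exact h.mono (MN_subset _ _ _)
      · right
        exact MCl.cons hc hv (MN_subset _ _ _) (fun z hz => (mem_MN.1 hz).2) h

lemma big_blue (X U : Finset V) (b : ℕ) (hb : 1 ≤ b) (μ : ℝ) 
    (hbM : (b : ℝ) ≤ μ * U.card) (hμ1 : μ ≤ 1)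
    (hU : ∀ u ∈ U, μ * X.card ≤ (MN c false u X).card) :
    ∃ S ⊆ U, S.card = b ∧ 
      (X.card : ℝ) * (μ - b / U.card) ^ b ≤ (X.filter (fun z => ∀ u ∈ S, z ≠ u ∧ c u z = false)).card := by
  classical
  have hM0 : (0 : ℝ) < U.card := by
    rcases Nat.eq_zero_or_pos U.card with h | h
    · rw [h] at hbM
      have : (1 : ℝ) ≤ b := by exact_mod_cast hb
      simp at hbM; linarith
    · exact_mod_cast h
  set a : V → ℕ := fun z => (U.filter (fun u => z ≠ u ∧ c u z = false)).card with ha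
  have hbM' : b ≤ U.card := by
    have : (b : ℝ) ≤ U.card := by nlinarith
    exact_mod_cast this
  have hcount : ∑ S ∈ U.powersetCard b, (X.filter (fun z => ∀ u ∈ S, z ≠ u ∧ c u z = false)).card
      = ∑ z ∈ X, (a z).choose b := by
    simp_rw [Finset.card_filter]
    rw [Finset.sum_comm]
    refine Finset.sum_congr rfl fun z hz => ?_
    rw [← Finset.card_filter, ha, ← Finset.card_powersetCard]
    congr 1
    ext S
    simp only [Finset.mem_filter, Finset.mem_powersetCard, Finset.subset_iff]
    constructor
    · rintro ⟨⟨h1, h2⟩, h3⟩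
      exact ⟨fun u hu => ⟨h1 hu, h3 u hu⟩, h2⟩
    · rintro ⟨h1, h2⟩
      exact ⟨⟨fun u hu => (h1 hu).1, h2⟩, fun u hu => (h1 hu).2⟩
  have hsum : ∑ z ∈ X, (a z : ℝ) = ∑ u ∈ U, ((MN c false u X).card : ℝ) := by
    simp only [ha, MN]
    simp_rw [Finset.card_filter]
    push_cast
    rw [Finset.sum_comm]
  have hsum2 : (X.card : ℝ) * (μ * U.card) ≤ ∑ z ∈ X, (a z : ℝ) := by
    rw [hsum]
    calc (X.card : ℝ) * (μ * U.card) = ∑ u ∈ U, μ * X.card := by simp; ring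
      _ ≤ _ := Finset.sum_le_sum hU
  have hchoose : ∀ z ∈ X, (max ((a z : ℝ) - b) 0) ^ b / (b.factorial : ℝ) ≤ ((a z).choose b : ℝ) := by
    intro z _
    refine le_trans ?_ (Nat.pow_le_choose (α := ℝ) b (a z))
    gcongr
    rcases le_total (b : ℕ) (a z) with h | h
    · rw [max_le_iff]
      constructor
      · rw [Nat.cast_sub (by omega)]; push_cast; linarith
      · positivity
    · rw [max_le_iff]
      constructor
      · have : (a z : ℝ) ≤ b := by exact_mod_cast h
        have h2 : (0 : ℝ) ≤ ((a z + 1 - b : ℕ) : ℝ) := by positivity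
        linarith
      · positivity
  have hjensen : (X.card : ℝ) * (μ * U.card - b) ^ b ≤ ∑ z ∈ X, (max ((a z : ℝ) - b) 0) ^ b := by
    obtain ⟨n, rfl⟩ : ∃ n, b = n + 1 := ⟨b - 1, by omega⟩
    have h1 := pow_sum_div_card_le_sum_pow (s := X) (f := fun z => max ((a z : ℝ) - ((n + 1 : ℕ) : ℝ)) 0) 
      (fun i _ => le_max_right _ _) n
    refine le_trans ?_ h1
    rcases Nat.eq_zero_or_pos X.card with h | h
    · rw [h]; simp
      have : X = ∅ := Finset.card_eq_zero.1 h
      subst this; simp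
    have hx : (0 : ℝ) < X.card := by exact_mod_cast h
    rw [le_div_iff₀ (by positivity)]
    calc (X.card : ℝ) * (μ * U.card - (n + 1 : ℕ)) ^ (n + 1) * X.card ^ n 
        = (X.card * (μ * U.card - (n + 1 : ℕ))) ^ (n + 1) := by rw [mul_pow]; ring
      _ ≤ _ := by
        refine pow_le_pow_left₀ ?_ ?_ _
        · have : 0 ≤ μ * U.card - ((n + 1 : ℕ) : ℝ) := by linarith
          positivity
        · calc (X.card : ℝ) * (μ * U.card - (n + 1 : ℕ)) ≤ ∑ z ∈ X, ((a z : ℝ) - ((n + 1 : ℕ) : ℝ)) := by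
                rw [Finset.sum_sub_distrib, Finset.sum_const, nsmul_eq_mul]; linarith
            _ ≤ _ := Finset.sum_le_sum (fun z _ => le_max_left _ _)
  have htot : ∑ S ∈ U.powersetCard b, ((X.card : ℝ) * (μ - b / U.card) ^ b) ≤ 
      ∑ S ∈ U.powersetCard b, ((X.filter (fun z => ∀ u ∈ S, z ≠ u ∧ c u z = false)).card : ℝ) := by
    have e : ∑ S ∈ U.powersetCard b, ((X.filter (fun z => ∀ u ∈ S, z ≠ u ∧ c u z = false)).card : ℝ)
      = ∑ z ∈ X, ((a z).choose b : ℝ) := by exact_mod_cast hcount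
    rw [e, Finset.sum_const, Finset.card_powersetCard, nsmul_eq_mul]
    have hnn : 0 ≤ μ - b / U.card := by
      rw [sub_nonneg, div_le_iff₀ hM0]; exact hbM
    calc (U.card.choose b : ℝ) * ((X.card : ℝ) * (μ - b / U.card) ^ b)
        ≤ ((U.card : ℝ) ^ b / b.factorial) * ((X.card : ℝ) * (μ - b / U.card) ^ b) := by
          gcongr
          exact Nat.choose_le_pow_div b U.card
      _ = (X.card : ℝ) * (μ * U.card - b) ^ b / b.factorial := by
          have : μ * U.card - b = U.card * (μ - b / U.card) := by field_simp
          rw [this, mul_pow]; ring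
      _ ≤ (∑ z ∈ X, (max ((a z : ℝ) - b) 0) ^ b) / b.factorial := by gcongr
      _ = ∑ z ∈ X, (max ((a z : ℝ) - b) 0) ^ b / b.factorial := by rw [Finset.sum_div]
      _ ≤ _ := Finset.sum_le_sum hchoose
  obtain ⟨S, hS, h⟩ := Finset.exists_le_of_sum_le (by simpa using hbM') htot
  rw [Finset.mem_powersetCard] at hS
  exact ⟨S, hS.1, hS.2, h⟩

end comb

lemma amgm_pow (J : ℕ) (a t : ℝ) (ha : 0 ≤ a) (ht : 0 ≤ t) :
    a * t ^ J ≤ ((a + J * t) / (J + 1)) ^ (J + 1) := by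
  rcases ht.eq_or_lt with rfl | ht
  · rcases J with _ | J
    · simp
    · simp; positivity
  have hJ : (0 : ℝ) < J + 1 := by positivity
  have h := one_add_mul_le_pow (a := (a + J * t) / ((J + 1) * t) - 1) (by
    have : 0 ≤ (a + J * t) / ((J + 1) * t) := by positivity
    linarith) (J + 1)
  have e : (1 : ℝ) + ((J + 1 : ℕ) : ℝ) * ((a + J * t) / ((J + 1) * t) - 1) = a / t := by
    push_cast; field_simp; ring
  rw [e] at h
  have e2 : (1 : ℝ) + ((a + J * t) / ((J + 1) * t) - 1) = ((a + J * t) / (J + 1)) / t := by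
    field_simp; ring
  rw [e2, div_pow, div_le_div_iff₀ ht (by positivity)] at h
  have h3 : a * t ^ J * t ≤ ((a + J * t) / (J + 1)) ^ (J + 1) * t := by
    calc a * t ^ J * t = a * t ^ (J + 1) := by ring
      _ ≤ _ := h
  exact le_of_mul_le_mul_right h3 ht


/-- excess of red edges between `X` and `Y` over density `p` -/
noncomputable def exc {V : Type*} [DecidableEq V] (c : V → V → Bool) (p : ℝ) (X Y : Finset V) : ℝ :=
  ∑ v ∈ X, (((MN c true v Y).card : ℝ) - p * Y.card)

section comb2
set_option linter.unusedSectionVars false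
variable {V : Type*} [DecidableEq V] {c : V → V → Bool}

lemma exc_le (p : ℝ) (hp : 0 ≤ p) (X Y : Finset V) : exc c p X Y ≤ X.card * Y.card := by
  unfold exc
  calc _ ≤ ∑ v ∈ X, (Y.card : ℝ) := by
        refine Finset.sum_le_sum fun v _ => ?_
        have : ((MN c true v Y).card : ℝ) ≤ Y.card := by
          exact_mod_cast Finset.card_le_card (MN_subset _ _ _)
        have : 0 ≤ p * Y.card := by positivity
        linarith
    _ = _ := by simp

lemma exc_split (p : ℝ) (X Y : Finset V) (v : V) (hv : v ∈ X) :
    exc c p X Y = exc c p (MN c true v X) Y + exc c p (MN c false v X) Y 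
      + (((MN c true v Y).card : ℝ) - p * Y.card) := by
  unfold exc
  rw [← Finset.sum_union, ← Finset.sum_erase_add _ _ hv]
  · congr 2
    ext z
    simp only [Finset.mem_union, mem_MN, Finset.mem_erase]
    cases c v z <;> simp [and_comm]
  · rw [Finset.disjoint_left]
    intro a ha hb
    rw [mem_MN] at ha hb
    simp_all

/-- convexity of codegrees -/
lemma codeg (hc : ∀ v w, c v w = c w v) (p : ℝ) (X Y : Finset V) :
    exc c p X Y * ∑ v ∈ X, ((MN c true v Y).card : ℝ) ≤
      Y.card * ∑ v ∈ X, exc c p X (MN c true v Y) := by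
  set h : V → ℝ := fun y => ∑ v ∈ X, (if y ≠ v ∧ c v y = true then (1 : ℝ) else 0) with hh
  have e1 : ∀ v, ((MN c true v Y).card : ℝ) = ∑ y ∈ Y, (if y ≠ v ∧ c v y = true then (1 : ℝ) else 0) := by
    intro v
    rw [MN, Finset.card_filter]; push_cast; rfl
  have e2 : ∑ v ∈ X, ((MN c true v Y).card : ℝ) = ∑ y ∈ Y, h y := by
    simp_rw [e1]; rw [Finset.sum_comm]
  have e3 : ∑ v ∈ X, ∑ u ∈ X, ((MN c true u (MN c true v Y)).card : ℝ) = ∑ y ∈ Y, h y ^ 2 := by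
    have : ∀ v u, ((MN c true u (MN c true v Y)).card : ℝ) = 
      ∑ y ∈ Y, (if y ≠ v ∧ c v y = true then (1 : ℝ) else 0) * (if y ≠ u ∧ c u y = true then (1 : ℝ) else 0) := by
      intro v u
      simp only [MN, Finset.filter_filter]
      rw [Finset.card_filter]; push_cast
      refine Finset.sum_congr rfl fun y _ => ?_
      by_cases h1 : y ≠ v ∧ c v y = true
      · rw [if_pos h1, one_mul]; simp only [h1, true_and, not_false_eq_true, ne_eq]
      · rw [if_neg h1, zero_mul, if_neg (fun h => h1 h.1)]
    simp_rw [this, hh, sq, Finset.sum_mul_sum]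
    rw [Finset.sum_comm' (t' := X) (s' := fun _ => X) (by simp)]
    conv_rhs => rw [Finset.sum_comm]
    rw [Finset.sum_comm]
    refine Finset.sum_congr rfl fun v _ => ?_
    conv_rhs => rw [Finset.sum_comm]
  have e4 : ∑ v ∈ X, exc c p X (MN c true v Y) = ∑ y ∈ Y, h y ^ 2 - p * X.card * ∑ y ∈ Y, h y := by
    unfold exc
    simp_rw [Finset.sum_sub_distrib]
    rw [e3, ← e2]
    congr 1
    simp only [Finset.sum_const, nsmul_eq_mul, Finset.mul_sum]
    refine Finset.sum_congr rfl fun v _ => ?_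
    ring
  have e5 : exc c p X Y = ∑ y ∈ Y, h y - p * X.card * Y.card := by
    unfold exc
    rw [Finset.sum_sub_distrib, e2]; simp; ring
  have e6 : (∑ y ∈ Y, h y) ^ 2 ≤ Y.card * ∑ y ∈ Y, h y ^ 2 := sq_sum_le_card_mul_sum_sq
  rw [e4, e5, e2]
  nlinarith

/-- choice of a good vertex -/
lemma choose_vertex (hc : ∀ v w, c v w = c w v) (p : ℝ) (hp : 0 < p) (X Y W : Finset V) (hW : W ⊆ X)
    (w : ℕ) (hw : W.card ≤ w) (hXw : 2 * w ≤ X.card) (hw1 : 1 ≤ w) (hpos : 0 < exc c p X Y) :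
    ∃ v ∈ X, v ∉ W ∧ exc c p X Y * (MN c true v Y).card - 2 * w * (Y.card : ℝ) ^ 2 ≤ 
      Y.card * exc c p X (MN c true v Y) := by
  by_contra hcon
  push Not at hcon
  have h1 := codeg hc p X Y
  set s : V → ℝ := fun v => Y.card * exc c p X (MN c true v Y) - exc c p X Y * (MN c true v Y).card with hs
  have h2 : 0 ≤ ∑ v ∈ X, s v := by
    simp only [hs]
    rw [Finset.sum_sub_distrib, ← Finset.mul_sum, ← Finset.mul_sum]; linarith
  have h3 : ∑ v ∈ X, s v = ∑ v ∈ X \ W, s v + ∑ v ∈ W, s v := (Finset.sum_sdiff hW).symm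
  have h4 : ∑ v ∈ W, s v ≤ ∑ v ∈ W, (X.card : ℝ) * Y.card ^ 2 := by
    refine Finset.sum_le_sum fun v _ => ?_
    have a1 : exc c p X (MN c true v Y) ≤ X.card * Y.card := by
      refine (exc_le p hp.le _ _).trans ?_
      gcongr
      exact MN_subset _ _ _
    have a2 : 0 ≤ exc c p X Y * (MN c true v Y).card := by positivity
    have a3 : (0 : ℝ) ≤ Y.card := by positivity
    simp only [hs]
    nlinarith
  have hne : (X \ W).Nonempty := by
    rw [← Finset.card_pos, Finset.card_sdiff_of_subset hW]; omega
  have h5 : ∑ v ∈ X \ W, s v < ∑ v ∈ X \ W, (-(2 * w * (Y.card : ℝ) ^ 2)) := by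
    refine Finset.sum_lt_sum_of_nonempty hne fun v hv => ?_
    rw [Finset.mem_sdiff] at hv
    have := hcon v hv.1 hv.2
    simp only [hs]
    linarith
  rw [Finset.sum_const, nsmul_eq_mul] at h4 h5
  have hcard : (X.card : ℝ) ≤ 2 * ((X \ W).card : ℝ) := by
    rw [Finset.card_sdiff_of_subset hW]
    have : X.card ≤ 2 * (X.card - W.card) := by omega
    exact_mod_cast this
  have hw' : (W.card : ℝ) ≤ w := by exact_mod_cast hw
  have hy : (0 : ℝ) ≤ (Y.card : ℝ) ^ 2 := by positivity
  have b1 : (W.card : ℝ) * (X.card * Y.card ^ 2) ≤ w * (X.card * Y.card ^ 2) := by gcongr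
  have b2 : (X.card : ℝ) * (w * Y.card ^ 2) ≤ 2 * ((X \ W).card : ℝ) * (w * Y.card ^ 2) := by gcongr
  nlinarith

end comb2

/-- the red/blue dichotomy, normalised -/
lemma dichotomy (J : ℕ) (p μ η AR AB : ℝ) (hμ0 : 0 ≤ μ) (hμ1 : μ ≤ 1)
    (hAR : 0 ≤ AR) (hAB : AR ≤ AB) (hη : (1 - μ) * AR + μ * AB < 1 - η)
    (B n y f nR nB nv FR FB : ℝ) (hp : 0 < p) (hn : 0 < n) (hy : 0 < y) (hf : 0 < f)
    (hnR : 0 ≤ nR) (hnB : 0 ≤ nB) (hsum : nR + nB ≤ n) (hB : nB ≤ μ * n) (hnv : p * y ≤ nv)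
    (hF : (1 - η) * f * nv ≤ (FR + FB) * y)
    (hpot : B * (n * y) ^ J ≤ f ^ (J + 1)) :
    (0 < FR ∧ (p * (1 - μ) * AR ^ (J + 1)) * B * (nR * nv) ^ J ≤ FR ^ (J + 1)) ∨
    (0 < FB ∧ (p * μ * AB ^ (J + 1)) * B * (nB * nv) ^ J ≤ FB ^ (J + 1)) := by
  have hnv0 : 0 < nv := lt_of_lt_of_le (by positivity) hnv
  have key : ∀ A m r F : ℝ, 0 ≤ A → 0 ≤ m → 0 ≤ r → 
      (0 < F → F ^ (J + 1) < (p * m * A ^ (J + 1)) * B * (r * nv) ^ J) →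
      F * y / (f * nv) ≤ A * ((m + J * (r / n)) / (J + 1)) := by
    intro A m r F hA hm hr h
    rcases le_or_gt F 0 with h0 | h0
    · have : F * y / (f * nv) ≤ 0 := div_nonpos_of_nonpos_of_nonneg (by nlinarith) (by positivity)
      exact this.trans (by positivity)
    have h1 := h h0
    refine le_of_pow_le_pow_left₀ (n := J + 1) (by omega) (by positivity) ?_
    have h2 := amgm_pow J m (r / n) hm (by positivity)
    rw [mul_pow]
    refine le_trans ?_ (mul_le_mul_of_nonneg_left h2 (by positivity))
    rw [div_pow, div_le_iff₀ (by positivity)]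
    have h3 : F ^ (J + 1) * (n * y) ^ J ≤ (p * m * A ^ (J + 1)) * (r * nv) ^ J * f ^ (J + 1) := by
      calc F ^ (J + 1) * (n * y) ^ J ≤ (p * m * A ^ (J + 1)) * B * (r * nv) ^ J * (n * y) ^ J := by gcongr
        _ = (p * m * A ^ (J + 1)) * (r * nv) ^ J * (B * (n * y) ^ J) := by ring
        _ ≤ _ := by gcongr
    have h4 : (F * y) ^ (J + 1) * n ^ J ≤ A ^ (J + 1) * (m * r ^ J) * (f * nv) ^ (J + 1) := by
      calc (F * y) ^ (J + 1) * n ^ J = (F ^ (J + 1) * (n * y) ^ J) * y := by ring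
        _ ≤ ((p * m * A ^ (J + 1)) * (r * nv) ^ J * f ^ (J + 1)) * y := by gcongr
        _ = (m * A ^ (J + 1)) * (r * nv) ^ J * f ^ (J + 1) * (p * y) := by ring
        _ ≤ (m * A ^ (J + 1)) * (r * nv) ^ J * f ^ (J + 1) * nv := by gcongr
        _ = _ := by ring
    have hnJ : 0 < n ^ J := by positivity
    refine le_of_mul_le_mul_right (h4.trans (le_of_eq ?_)) hnJ
    rw [div_pow]
    field_simp
  by_contra hcon
  push Not at hcon
  have k1 := key AR (1 - μ) nR FR hAR (by linarith) hnR hcon.1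
  have k2 := key AB μ nB FB (hAR.trans hAB) hμ0 hnB hcon.2
  have k3 : 1 - η ≤ FR * y / (f * nv) + FB * y / (f * nv) := by
    rw [← add_div, le_div_iff₀ (by positivity)]
    linarith
  set β := nB / n with hβ
  have hβμ : β ≤ μ := by rw [hβ, div_le_iff₀ hn]; exact hB
  have hρ : nR / n ≤ 1 - β := by
    rw [hβ, div_le_iff₀ hn, sub_mul, div_mul_cancel₀ _ hn.ne']; linarith
  have k4 : AR * ((1 - μ + J * (nR / n)) / (J + 1)) ≤ AR * ((1 - μ + J * (1 - β)) / (J + 1)) := by gcongr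
  have hJ : (0 : ℝ) < J + 1 := by positivity
  have k5 : AR * ((1 - μ + J * (1 - β)) / (J + 1)) + AB * ((μ + J * β) / (J + 1)) 
      = (1 - μ) * AR + μ * AB - (J / (J + 1)) * ((μ - β) * (AB - AR)) := by
    field_simp; ring
  have k6 : 0 ≤ ((J : ℝ) / (J + 1)) * ((μ - β) * (AB - AR)) := by
    have : 0 ≤ μ - β := by linarith
    have : 0 ≤ AB - AR := by linarith
    positivity
  linarith


lemma removal_real (J : ℕ) (B n y f g : ℝ) (hn : 1 ≤ n) (hf : 0 < f) 
    (hg : (J + 1) * g * n < J * f) (hpot : B * (n * y) ^ J ≤ f ^ (J + 1)) :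
    0 < f - g ∧ B * ((n - 1) * y) ^ J ≤ (f - g) ^ (J + 1) := by
  have hn0 : 0 < n := by linarith
  have hJ : (0 : ℝ) < J + 1 := by positivity
  have h1 : f * ((1 + J * ((n - 1) / n)) / (J + 1)) ≤ f - g := by
    have e : f * ((1 + J * ((n - 1) / n)) / (J + 1)) = f - J * f / ((J + 1) * n) := by
      field_simp; ring
    rw [e]
    have : g ≤ J * f / ((J + 1) * n) := by
      rw [le_div_iff₀ (by positivity)]; linarith
    linarith
  have ht : 0 ≤ (n - 1) / n := div_nonneg (by linarith) hn0.le
  have h2 := amgm_pow J 1 ((n - 1) / n) zero_le_one ht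
  refine ⟨lt_of_lt_of_le (by positivity) h1, ?_⟩
  calc B * ((n - 1) * y) ^ J = (B * (n * y) ^ J) * ((n - 1) / n) ^ J := by
        rw [mul_assoc, ← mul_pow]; congr 2; field_simp
    _ ≤ f ^ (J + 1) * ((n - 1) / n) ^ J := by gcongr
    _ ≤ f ^ (J + 1) * ((1 + J * ((n - 1) / n)) / (J + 1)) ^ (J + 1) := by
        gcongr; linarith
    _ = (f * ((1 + J * ((n - 1) / n)) / (J + 1))) ^ (J + 1) := by rw [mul_pow]
    _ ≤ _ := by gcongr

lemma eighth_pow (J : ℕ) (hJ : 1 ≤ J) : (1 / 8 : ℝ) ≤ ((J : ℝ) / (J + 1)) ^ (J + 1) := by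
  have hJ' : (1 : ℝ) ≤ J := by exact_mod_cast hJ
  have h1 : ((J + 1 : ℝ) / J) ^ (J + 1) ≤ 8 := by
    have h2 : (J + 1 : ℝ) / J ≤ Real.exp (1 / J) := by
      have := Real.add_one_le_exp (1 / (J : ℝ))
      have e : (J + 1 : ℝ) / J = 1 / J + 1 := by field_simp; ring
      rw [e]; exact this
    calc ((J + 1 : ℝ) / J) ^ (J + 1) ≤ Real.exp (1 / J) ^ (J + 1) := by gcongr
      _ = Real.exp (((J + 1 : ℕ) : ℝ) * (1 / J)) := by rw [Real.exp_nat_mul]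
      _ ≤ Real.exp 2 := by
        apply Real.exp_le_exp.2
        push_cast
        rw [mul_one_div, div_le_iff₀ (by linarith)]; linarith
      _ = Real.exp 1 ^ 2 := by rw [← Real.exp_nat_mul]; norm_num
      _ ≤ 8 := by
        have := Real.exp_one_lt_d9
        have := Real.exp_pos 1
        nlinarith
  have e : ((J : ℝ) / (J + 1)) ^ (J + 1) = (((J + 1 : ℝ) / J) ^ (J + 1))⁻¹ := by
    rw [← inv_pow, inv_div]
  rw [e, one_div]
  exact inv_anti₀ (by positivity) h1

lemma blue_alg (J : ℕ) (B t n y : ℝ) (hn : 0 < n) : 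
    B * (t / n * (1 / 8)) * (t * y) ^ J = (1 / 8) * (B * (n * y) ^ J) * (t / n) ^ (J + 1) := by
  have : (t * y) ^ J = (n * y) ^ J * (t / n) ^ J := by
    rw [← mul_pow]; congr 1; field_simp
  rw [this]; ring

set_option maxHeartbeats 2000000 in
theorem main_induction {V : Type*} [DecidableEq V] {c : V → V → Bool} (hc : ∀ v w, c v w = c w v)
    (p μ η AR AB A C : ℝ) (J b M w k0 m : ℕ)
    (hp : 0 < p) (hμ0 : 0 < μ) (hμ1 : μ < 1) (hη0 : 0 < η)
    (hAR : 0 < AR) (hAB : AR ≤ AB) (hη : (1 - μ) * AR + μ * AB < 1 - η)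
    (x ν : ℝ) (hx : x = p * (1 - μ) * AR ^ (J + 1)) (hν : ν = p * μ * AB ^ (J + 1)) (hν1 : ν ≤ 1)
    (hJ : 1 ≤ J) (hb : 1 ≤ b) (hbM : (b : ℝ) < μ * M) (hbν : ν ^ b ≤ (μ - b / M) ^ b / 8)
    (hw1 : 1 ≤ w) (hw : ∀ k ≤ k0, ∀ S : Finset V, w ≤ S.card → MCl c true k S ∨ MCl c false M S)
    (hA0 : 0 < A)
    (hA : ∀ k ≤ k0, ∀ S : Finset V, A * x⁻¹ ^ k ≤ S.card → MCl c true k S ∨ MCl c false m S)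
    (hC1 : 2 * w ≤ C) (hC2 : 2 * w / p + 1 ≤ η * C) :
    ∀ n : ℕ, ∀ X : Finset V, X.card = n → ∀ Y : Finset V, ∀ k l : ℕ, k ≤ k0 → 0 < exc c p X Y →
      C * A * x⁻¹ ^ k * ν⁻¹ ^ l * ((X.card : ℝ) * Y.card) ^ J ≤ (exc c p X Y) ^ (J + 1) →
      MCl c true k (X ∪ Y) ∨ MCl c false l X ∨ MCl c false m Y := by
  have hx0 : 0 < x := by
    have : 0 < 1 - μ := by linarith
    rw [hx]; positivity
  have hAB0 : 0 < AB := lt_of_lt_of_le hAR hAB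
  have hν0 : 0 < ν := by rw [hν]; positivity
  have hw1' : (1 : ℝ) ≤ w := by exact_mod_cast hw1
  have hC0 : 0 < C := by linarith
  intro n
  induction n using Nat.strong_induction_on with
  | _ n ih =>
  intro X hXn Y k l hk hf hpot
  by_cases hk0 : k = 0
  · subst hk0; left; exact MCl.zero _ _ _
  by_cases hl0 : l = 0
  · subst hl0; right; left; exact MCl.zero _ _ _
  by_cases hYbig : A * x⁻¹ ^ k ≤ Y.card
  · rcases hA k hk Y hYbig with h | h
    · left; exact h.mono Finset.subset_union_right
    · right; right; exact h
  push Not at hYbig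
  set f := exc c p X Y with hfdef
  have hfle : f ≤ X.card * Y.card := exc_le p hp.le X Y
  have hXY : (0 : ℝ) < X.card * Y.card := lt_of_lt_of_le hf hfle
  have hY0 : (0 : ℝ) < Y.card := by
    by_contra h
    have : (Y.card : ℝ) = 0 := le_antisymm (not_lt.1 h) (by positivity)
    rw [this, mul_zero] at hXY; exact lt_irrefl _ hXY
  have hX0 : (0 : ℝ) < X.card := by
    by_contra h
    have : (X.card : ℝ) = 0 := le_antisymm (not_lt.1 h) (by positivity)
    rw [this, zero_mul] at hXY; exact lt_irrefl _ hXY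
  have hX1 : (1 : ℝ) ≤ X.card := by
    have : 0 < X.card := by exact_mod_cast hX0
    exact_mod_cast this
  have hνl : 1 ≤ ν⁻¹ ^ l := one_le_pow₀ ((one_le_inv₀ hν0).2 hν1)
  have hCf : C * Y.card ≤ f := by
    have h1 : C * Y.card * (X.card * Y.card : ℝ) ^ J ≤ f * (X.card * Y.card : ℝ) ^ J := by
      calc C * Y.card * (X.card * Y.card : ℝ) ^ J 
          ≤ C * (A * x⁻¹ ^ k) * (X.card * Y.card : ℝ) ^ J := by gcongr
        _ = C * A * x⁻¹ ^ k * 1 * (X.card * Y.card : ℝ) ^ J := by ring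
        _ ≤ C * A * x⁻¹ ^ k * ν⁻¹ ^ l * (X.card * Y.card : ℝ) ^ J := by gcongr
        _ ≤ f ^ (J + 1) := hpot
        _ = f * f ^ J := by ring
        _ ≤ _ := by gcongr
    exact le_of_mul_le_mul_right h1 (by positivity)
  have hCX : C ≤ X.card := by
    have : C * Y.card ≤ X.card * Y.card := hCf.trans hfle
    exact le_of_mul_le_mul_right this hY0
  set B := C * A * x⁻¹ ^ k * ν⁻¹ ^ l with hB
  have hB0 : 0 < B := by positivity
  -- removal of low degree vertices
  by_cases hreg : ∃ v ∈ X, (J + 1) * (((MN c true v Y).card : ℝ) - p * Y.card) * X.card < J * f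
  · obtain ⟨v, hv, hlow⟩ := hreg
    obtain ⟨h1, h2⟩ := removal_real J B X.card Y.card f _ hX1 hf hlow hpot
    have e1 : exc c p (X.erase v) Y = f - (((MN c true v Y).card : ℝ) - p * Y.card) := by
      rw [hfdef, exc, exc, ← Finset.sum_erase_add _ _ hv]; ring
    have e2 : ((X.erase v).card : ℝ) = X.card - 1 := by
      rw [← Finset.card_erase_add_one hv]; push_cast; ring
    rw [← e1] at h1 h2
    rw [← e2] at h2
    have hlt : (X.erase v).card < n := by
      rw [← hXn]; exact Finset.card_erase_lt_of_mem hv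
    rcases ih _ hlt (X.erase v) rfl Y k l hk h1 h2 with h | h | h
    · left; exact h.mono (Finset.union_subset_union_left (Finset.erase_subset _ _))
    · right; left; exact h.mono (Finset.erase_subset _ _)
    · right; right; exact h
  push Not at hreg
  -- big blue step
  set W := X.filter (fun v => μ * X.card ≤ (MN c false v X).card) with hW
  by_cases hWbig : w ≤ W.card
  · rcases hw k hk W hWbig with h | h
    · left; exact h.mono ((Finset.filter_subset _ _).trans Finset.subset_union_left)
    obtain ⟨U, hUW, hUM, hUcl⟩ := h
    have hUX : U ⊆ X := hUW.trans (Finset.filter_subset _ _)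
    obtain ⟨S, hSU, hSb, hST⟩ := big_blue (c := c) X U b hb μ (by rw [hUM]; exact hbM.le) hμ1.le
      (fun u hu => (Finset.mem_filter.1 (hUW hu)).2)
    have hScl : ∀ v ∈ S, ∀ w ∈ S, v ≠ w → c v w = false := 
      fun v hv w hw => hUcl v (hSU hv) w (hSU hw)
    by_cases hlb : l ≤ b
    · right; left
      exact MCl.mono_size ⟨S, hSU.trans hUX, hSb, hScl⟩ hlb
    push Not at hlb
    set T := X.filter (fun z => ∀ u ∈ S, z ≠ u ∧ c u z = false) with hT
    rw [hUM] at hST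
    have hM0 : (0 : ℝ) < M := by
      have : (1 : ℝ) ≤ b := by exact_mod_cast hb
      by_contra h
      have : (M : ℝ) ≤ 0 := not_lt.1 h
      nlinarith
    have hθ0 : 0 < μ - b / M := by
      rw [sub_pos, div_lt_iff₀ hM0]; exact hbM
    have hTX : T ⊆ X := Finset.filter_subset _ _
    have hT0 : (0 : ℝ) < T.card := lt_of_lt_of_le (by positivity) hST
    have hTlt : T.card < n := by
      rw [← hXn]
      apply Finset.card_lt_card
      refine ⟨hTX, fun hsub => ?_⟩
      have : S.Nonempty := by rw [← Finset.card_pos]; omega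
      obtain ⟨s, hs⟩ := this
      have h1 := hsub (hUX (hSU hs))
      exact ((Finset.mem_filter.1 h1).2 s hs).1 rfl
    have hfT : (J / (J + 1) : ℝ) * f * (T.card / X.card) ≤ exc c p T Y := by
      have : ∀ v ∈ T, J * f / ((J + 1) * X.card) ≤ ((MN c true v Y).card : ℝ) - p * Y.card := by
        intro v hv
        rw [div_le_iff₀ (by positivity)]
        have := hreg v (hTX hv)
        linarith
      have h2 := Finset.sum_le_sum this
      rw [Finset.sum_const, nsmul_eq_mul] at h2
      refine le_trans (le_of_eq ?_) h2
      field_simp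
    have hJ0 : (0 : ℝ) < J := by exact_mod_cast hJ
    have hfT0 : 0 < exc c p T Y := lt_of_lt_of_le (by positivity) hfT
    have hpotT : C * A * x⁻¹ ^ k * ν⁻¹ ^ (l - b) * ((T.card : ℝ) * Y.card) ^ J ≤ (exc c p T Y) ^ (J + 1) := by
      have hνsplit : ν⁻¹ ^ (l - b) = ν⁻¹ ^ l * ν ^ b := by
        have : ν⁻¹ ^ l = ν⁻¹ ^ (l - b) * ν⁻¹ ^ b := by rw [← pow_add]; congr 1; omega
        rw [this, mul_assoc, ← mul_pow, inv_mul_cancel₀ hν0.ne', one_pow, mul_one]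
      have hTr : (μ - b / M) ^ b ≤ (T.card : ℝ) / X.card := by
        rw [le_div_iff₀ hX0]; linarith
      calc C * A * x⁻¹ ^ k * ν⁻¹ ^ (l - b) * ((T.card : ℝ) * Y.card) ^ J 
          = B * ν ^ b * ((T.card : ℝ) * Y.card) ^ J := by rw [hνsplit, hB]; ring
        _ ≤ B * ((T.card : ℝ) / X.card * (1 / 8)) * ((T.card : ℝ) * Y.card) ^ J := by
            gcongr
            linarith
        _ = (1 / 8) * (B * (X.card * Y.card : ℝ) ^ J) * ((T.card : ℝ) / X.card) ^ (J + 1) := by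
            exact blue_alg J B _ _ _ hX0
        _ ≤ ((J : ℝ) / (J + 1)) ^ (J + 1) * f ^ (J + 1) * ((T.card : ℝ) / X.card) ^ (J + 1) := by
            gcongr
            exact eighth_pow J hJ
        _ = ((J / (J + 1) : ℝ) * f * (T.card / X.card)) ^ (J + 1) := by rw [mul_pow, mul_pow]
        _ ≤ _ := by gcongr
    rcases ih _ hTlt T rfl Y k (l - b) hk hfT0 hpotT with h | h | h
    · left; exact h.mono (Finset.union_subset_union_left hTX)
    · right; left
      have := MCl.join (S := S) hc (hSU.trans hUX) hTX hScl (fun z hz => (Finset.mem_filter.1 hz).2) h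
      rw [hSb, Nat.sub_add_cancel hlb.le] at this
      exact this
    · right; right; exact h
  push Not at hWbig
  -- red or boost step
  have hXw : 2 * w ≤ X.card := by
    have : (2 * w : ℝ) ≤ X.card := hC1.trans hCX
    exact_mod_cast this
  obtain ⟨v, hvX, hvW, hv⟩ := choose_vertex hc p hp X Y W (Finset.filter_subset _ _) w hWbig.le hXw hw1 hf
  have hvB : ((MN c false v X).card : ℝ) ≤ μ * X.card := by
    by_contra h
    push Not at h
    exact hvW (Finset.mem_filter.2 ⟨hvX, h.le⟩)
  have hJ0 : (0 : ℝ) < J := by exact_mod_cast hJ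
  have hnv : p * Y.card ≤ (MN c true v Y).card := by
    by_contra h
    push Not at h
    have h1 := hreg v hvX
    have h2 : 0 < J * f := by positivity
    have h3 : (J + 1) * (((MN c true v Y).card : ℝ) - p * Y.card) * X.card ≤ 0 := by
      have : 0 ≤ ((J : ℝ) + 1) * X.card := by positivity
      nlinarith
    linarith
  set Nv := MN c true v Y with hNv
  set XR := MN c true v X with hXR
  set XB := MN c false v X with hXB
  have hcard : (XR.card : ℝ) + XB.card ≤ X.card := by
    have : XR.card + XB.card + 1 = X.card := MN_card_add (c := c) hvX
    have : XR.card + XB.card ≤ X.card := by omega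
    exact_mod_cast this
  have hNv0 : (0 : ℝ) < Nv.card := lt_of_lt_of_le (by positivity) hnv
  have hF : (1 - η) * f * Nv.card ≤ (exc c p XR Nv + exc c p XB Nv) * Y.card := by
    have h1 := exc_split (c := c) p X Nv v hvX
    have h2 : ((MN c true v Nv).card : ℝ) - p * Nv.card ≤ Nv.card := by
      have : ((MN c true v Nv).card : ℝ) ≤ Nv.card := by
        exact_mod_cast Finset.card_le_card (MN_subset _ _ _)
      have : 0 ≤ p * Nv.card := by positivity
      linarith
    have h3 : exc c p X Nv - Nv.card ≤ exc c p XR Nv + exc c p XB Nv := by linarith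
    have h4 : (exc c p X Nv - Nv.card) * Y.card ≤ (exc c p XR Nv + exc c p XB Nv) * Y.card := by gcongr
    refine le_trans ?_ h4
    have h5 : 2 * w * (Y.card : ℝ) ^ 2 ≤ 2 * w / p * Y.card * Nv.card := by
      calc 2 * w * (Y.card : ℝ) ^ 2 = 2 * w / p * Y.card * (p * Y.card) := by field_simp
        _ ≤ _ := by gcongr
    have h6 : (2 * w / p + 1) * Y.card * Nv.card ≤ η * f * Nv.card := by
      calc (2 * w / p + 1) * Y.card * Nv.card ≤ (η * C) * Y.card * Nv.card := by gcongr
        _ = η * (C * Y.card) * Nv.card := by ring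
        _ ≤ _ := by gcongr
    nlinarith
  have hxk : ∀ j, x * (C * A * x⁻¹ ^ (j + 1) * ν⁻¹ ^ l) = C * A * x⁻¹ ^ j * ν⁻¹ ^ l := by
    intro j; rw [pow_succ]; field_simp
  have hνk : ∀ j, ν * (C * A * x⁻¹ ^ k * ν⁻¹ ^ (j + 1)) = C * A * x⁻¹ ^ k * ν⁻¹ ^ j := by
    intro j; rw [pow_succ]; field_simp
  have hlt1 : XR.card < n := by
    have : XR.card + XB.card + 1 = X.card := MN_card_add (c := c) hvX
    omega
  have hlt2 : XB.card < n := by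
    have : XR.card + XB.card + 1 = X.card := MN_card_add (c := c) hvX
    omega
  rcases dichotomy J p μ η AR AB hμ0.le hμ1.le hAR.le hAB hη B X.card Y.card f XR.card XB.card Nv.card
    (exc c p XR Nv) (exc c p XB Nv) hp hX0 hY0 hf (by positivity) (by positivity) hcard hvB hnv hF hpot with
    ⟨g1, g2⟩ | ⟨g1, g2⟩
  · obtain ⟨j, rfl⟩ : ∃ j, k = j + 1 := ⟨k - 1, by omega⟩
    rw [← hx, hB, hxk] at g2
    rcases ih _ hlt1 XR rfl Nv j l (by omega) g1 g2 with h | h | h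
    · left
      refine MCl.cons hc (Finset.mem_union_left _ hvX) 
        (Finset.union_subset_union (MN_subset _ _ _) (MN_subset _ _ _)) ?_ h
      intro z hz
      rcases Finset.mem_union.1 hz with hz | hz
      · exact (mem_MN.1 hz).2
      · exact (mem_MN.1 hz).2
    · right; left; exact h.mono (MN_subset _ _ _)
    · right; right; exact h.mono (MN_subset _ _ _)
  · obtain ⟨j, rfl⟩ : ∃ j, l = j + 1 := ⟨l - 1, by omega⟩
    rw [← hν, hB, hνk] at g2
    rcases ih _ hlt2 XB rfl Nv k j hk g1 g2 with h | h | h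
    · left
      exact h.mono (Finset.union_subset_union (MN_subset _ _ _) (MN_subset _ _ _))
    · right; left
      exact MCl.cons hc hvX (MN_subset _ _ _) (fun z hz => (mem_MN.1 hz).2) h
    · right; right; exact h.mono (MN_subset _ _ _)


lemma choose_mul_le_one (k m : ℕ) (x y : ℝ) (hx : 0 ≤ x) (hy : 0 ≤ y) (hxy : x + y = 1) :
    ((k + m).choose k : ℝ) * x ^ k * y ^ m ≤ 1 := by
  have h := add_pow x y (k + m)
  rw [hxy, one_pow] at h
  have h2 : x ^ k * y ^ (k + m - k) * ((k + m).choose k : ℝ) ≤ 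
    ∑ i ∈ Finset.range (k + m + 1), x ^ i * y ^ (k + m - i) * ((k + m).choose i : ℝ) :=
    Finset.single_le_sum (f := fun i => x ^ i * y ^ (k + m - i) * ((k + m).choose i : ℝ)) 
      (fun i _ => by positivity) (Finset.mem_range.2 (by omega))
  rw [← h, Nat.add_sub_cancel_left] at h2
  linarith

lemma AR_AB_bound (σ μ L K : ℝ) (hσ0 : 0 < σ) (hσ1 : σ < 1) (hμ0 : 0 < μ) (hμ1 : μ ≤ 1 / 4)
    (hL0 : 0 ≤ L) (hL1 : L ≤ 1 / 2) (hK : 16 / σ ≤ K) :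
    (1 - μ) * Real.exp (-(σ + μ * L / (1 - μ)) / K) + μ * Real.exp ((L - σ) / K) < 1 - σ / (2 * K) := by
  have hK16 : 16 ≤ K * σ := by rwa [div_le_iff₀ hσ0] at hK
  have hK0 : 16 < K := by nlinarith
  have hK' : 0 < K := by linarith
  have h1μ : 0 < 1 - μ := by linarith
  set a := μ * L / (1 - μ) with ha
  have ha0 : 0 ≤ a := by positivity
  have ha1 : a ≤ 1 := by rw [ha, div_le_one h1μ]; nlinarith
  have haμ : (1 - μ) * a = μ * L := by rw [ha]; field_simp
  have b1 : |(-(σ + a) / K)| ≤ 2 / K := by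
    rw [abs_div, abs_neg, abs_of_pos hK', abs_of_nonneg (by positivity)]
    gcongr; linarith
  have b2 : |((L - σ) / K)| ≤ 2 / K := by
    rw [abs_div, abs_of_pos hK']
    gcongr
    rw [abs_le]; constructor <;> linarith
  have hK2 : 2 / K ≤ 1 := by rw [div_le_one hK']; linarith
  have e1 := (abs_le.1 (Real.abs_exp_sub_one_sub_id_le (b1.trans hK2))).2
  have e2 := (abs_le.1 (Real.abs_exp_sub_one_sub_id_le (b2.trans hK2))).2
  have s1 : (-(σ + a) / K) ^ 2 ≤ (2 / K) ^ 2 := by rw [← sq_abs]; gcongr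
  have s2 : ((L - σ) / K) ^ 2 ≤ (2 / K) ^ 2 := by rw [← sq_abs]; gcongr
  have f1 : Real.exp (-(σ + a) / K) ≤ 1 + -(σ + a) / K + (2 / K) ^ 2 := by linarith
  have f2 : Real.exp ((L - σ) / K) ≤ 1 + (L - σ) / K + (2 / K) ^ 2 := by linarith
  have g : (1 - μ) * Real.exp (-(σ + a) / K) + μ * Real.exp ((L - σ) / K) ≤ 
      (1 - μ) * (1 + -(σ + a) / K + (2 / K) ^ 2) + μ * (1 + (L - σ) / K + (2 / K) ^ 2) := by gcongr
  have e : (1 - μ) * (1 + -(σ + a) / K + (2 / K) ^ 2) + μ * (1 + (L - σ) / K + (2 / K) ^ 2) 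
      = 1 - σ / K + 4 / K ^ 2 + (μ * L - (1 - μ) * a) / K := by
    field_simp; ring
  rw [e, haμ, sub_self, zero_div, add_zero] at g
  refine lt_of_le_of_lt g ?_
  have : 4 / K ^ 2 < σ / (2 * K) := by
    rw [div_lt_div_iff₀ (by positivity) (by positivity)]
    nlinarith
  have h2 : σ / K = σ / (2 * K) + σ / (2 * K) := by field_simp; ring
  linarith

set_option maxHeartbeats 2000000 in
theorem book_thm (σ μ0 : ℝ) (hσ0 : 0 < σ) (hσ1 : σ < 1) (hμ00 : 0 < μ0) :
    ∃ J M : ℕ, ∃ c0 : ℝ, 0 < c0 ∧ ∀ (V : Type) [DecidableEq V] (c : V → V → Bool), (∀ v w, c v w = c w v) →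
      ∀ p μ : ℝ, 7 / 10 ≤ p → p < 1 → μ0 ≤ μ → μ ≤ 1 / 4 → ∀ x : ℝ, 
      x = (1 - μ) * Real.exp (-σ + Real.log p / (1 - μ)) → 
      ∀ (k m : ℕ) (X : Finset V), 0 < exc c p X X →
      c0 * ((k + M).choose k : ℝ) * (1 - x)⁻¹ ^ m * x⁻¹ ^ k * (μ * Real.exp (-σ))⁻¹ ^ m 
        * ((X.card : ℝ) * X.card) ^ J ≤ (exc c p X X) ^ (J + 1) →
      MCl c true k X ∨ MCl c false m X := by
  obtain ⟨J, hJ⟩ := exists_nat_ge (16 / σ)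
  obtain ⟨b', hb'⟩ := exists_nat_ge (16 / σ)
  set b := b' + 1 with hbdef
  have hb : 16 / σ ≤ b := by rw [hbdef]; push_cast; linarith
  have hs : 0 < 1 - Real.exp (-(σ / 2)) := by
    have : Real.exp (-(σ / 2)) < 1 := by rw [← Real.exp_zero]; exact Real.exp_lt_exp.2 (by linarith)
    linarith
  obtain ⟨M', hM'⟩ := exists_nat_ge (b / (μ0 * (1 - Real.exp (-(σ / 2)))))
  set M := M' + 1 with hMdef
  have hM : b / (μ0 * (1 - Real.exp (-(σ / 2)))) ≤ M := by rw [hMdef]; push_cast; linarith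
  have hM0 : (0 : ℝ) < M := by rw [hMdef]; positivity
  have hbM : (b : ℝ) / M ≤ μ0 * (1 - Real.exp (-(σ / 2))) := by
    rw [div_le_iff₀ (by positivity)] at hM
    rw [div_le_iff₀ hM0]; linarith
  have hJ16 : (16 : ℝ) < J := by
    rw [div_le_iff₀ hσ0] at hJ
    nlinarith
  set K : ℝ := J + 1 with hK
  have hK0 : 0 < K := by rw [hK]; positivity
  set η := σ / (2 * K) with hη
  have hη0 : 0 < η := by positivity
  refine ⟨J, M, 5 / η + 2, by positivity, ?_⟩
  intro V _ c hc p μ hp hp1 hμ hμ1 x hx k m X hexc hpot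
  have hp0 : 0 < p := by linarith
  have hμ0 : 0 < μ := by linarith
  have h1μ : 0 < 1 - μ := by linarith
  set L := -Real.log p with hL
  have hL0 : 0 ≤ L := by
    have := Real.log_nonpos hp0.le hp1.le
    linarith
  have hL1 : L ≤ 1 / 2 := by
    have := Real.one_sub_inv_le_log_of_pos hp0
    have h2 : p⁻¹ ≤ (7 / 10)⁻¹ := inv_anti₀ (by norm_num) hp
    norm_num at h2
    linarith
  have hpexp : p = Real.exp (-L) := by rw [hL, neg_neg, Real.exp_log hp0]
  have hKpow : ∀ t : ℝ, Real.exp (t / K) ^ (J + 1) = Real.exp t := by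
    intro t
    rw [← Real.exp_nat_mul]
    congr 1
    push_cast; rw [← hK]; field_simp
  set AR := Real.exp (-(σ + μ * L / (1 - μ)) / K) with hAR
  set AB := Real.exp ((L - σ) / K) with hAB
  have hx2 : x = p * (1 - μ) * AR ^ (J + 1) := by
    rw [hx, hAR, hKpow]
    have : p * (1 - μ) * Real.exp (-(σ + μ * L / (1 - μ))) = 
      (1 - μ) * (Real.exp (-L) * Real.exp (-(σ + μ * L / (1 - μ)))) := by rw [← hpexp]; ring
    rw [this, ← Real.exp_add]
    congr 2
    rw [hL]; field_simp; ring
  have hν2 : μ * Real.exp (-σ) = p * μ * AB ^ (J + 1) := by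
    rw [hAB, hKpow]
    have : p * μ * Real.exp (L - σ) = μ * (Real.exp (-L) * Real.exp (L - σ)) := by rw [← hpexp]; ring
    rw [this, ← Real.exp_add]
    congr 2
    ring
  have hx0 : 0 < x := by rw [hx]; positivity
  have hx1 : x < 1 := by
    have : Real.exp (-σ + Real.log p / (1 - μ)) < 1 := by
      refine lt_of_lt_of_eq (Real.exp_lt_exp.2 (?_ : _ < (0 : ℝ))) Real.exp_zero
      have : Real.log p / (1 - μ) ≤ 0 := div_nonpos_of_nonpos_of_nonneg (by linarith) h1μ.le
      linarith
    rw [hx]; nlinarith [Real.exp_pos (-σ + Real.log p / (1 - μ))]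
  have hσexp : Real.exp (-σ) ≤ 1 := Real.exp_le_one_iff.2 (by linarith)
  have hw1 : 1 ≤ (k + M).choose k := Nat.choose_pos (by omega)
  have hw1' : (1 : ℝ) ≤ (k + M).choose k := by exact_mod_cast hw1
  have key := main_induction (V := V) hc p μ η AR AB ((1 - x)⁻¹ ^ m) ((5 / η + 2) * ((k + M).choose k : ℝ)) 
    J b M ((k + M).choose k) k m hp0 hμ0 (by linarith) hη0 (Real.exp_pos _) ?_ ?_ x (μ * Real.exp (-σ)) 
    hx2 hν2 ?_ ?_ (by omega) ?_ ?_ hw1 ?_ ?_ ?_ ?_ ?_ X.card X rfl X k m le_rfl hexc hpot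
  · rw [Finset.union_self] at key
    tauto
  · apply Real.exp_le_exp.2
    gcongr
    have : 0 ≤ μ * L / (1 - μ) := by positivity
    linarith
  · exact AR_AB_bound σ μ L K hσ0 hσ1 hμ0 hμ1 hL0 hL1 (by rw [hK]; linarith)
  · nlinarith [Real.exp_pos (-σ)]
  · have : (1 : ℝ) ≤ J := by linarith
    exact_mod_cast this
  · have h1 : (b : ℝ) / M < μ := by nlinarith [Real.exp_pos (-(σ / 2))]
    rwa [div_lt_iff₀ hM0] at h1
  · have h1 : μ * Real.exp (-(σ / 2)) ≤ μ - b / M := by nlinarith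
    have h2 : Real.exp (-(σ / 2)) ^ b ≤ 1 / 8 := by
      rw [← Real.exp_nat_mul]
      have hbσ : 16 ≤ b * σ := by rwa [div_le_iff₀ hσ0] at hb
      have h3 : Real.exp (b * -(σ / 2)) ≤ Real.exp (-8) := Real.exp_le_exp.2 (by linarith)
      have h4 : Real.exp (-8) ≤ 1 / 8 := by
        rw [Real.exp_neg, one_div]
        apply inv_anti₀ (by norm_num)
        linarith [Real.add_one_le_exp (8 : ℝ)]
      linarith
    calc (μ * Real.exp (-σ)) ^ b = (μ * Real.exp (-(σ / 2))) ^ b * Real.exp (-(σ / 2)) ^ b := by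
          rw [← mul_pow]; congr 1
          rw [mul_assoc, ← Real.exp_add]; congr 2; ring
      _ ≤ (μ - b / M) ^ b * (1 / 8) := by
          have h0 : 0 < μ * Real.exp (-(σ / 2)) := by positivity
          have h00 : 0 ≤ μ - b / M := by linarith
          gcongr
      _ = _ := by ring
  · intro k' hk' S hS
    apply erdos_szekeres hc (k' + M) k' M rfl
    refine le_trans ?_ hS
    rw [Nat.choose_symm_add, Nat.choose_symm_add]
    exact Nat.choose_le_choose _ (by omega)
  · have : 0 < 1 - x := by linarith
    positivity
  · intro k' hk' S hS
    apply erdos_szekeres hc (k' + m) k' m rfl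
    have h1 := choose_mul_le_one k' m x (1 - x) hx0.le (by linarith) (by ring)
    have h2 : ((k' + m).choose k' : ℝ) ≤ (1 - x)⁻¹ ^ m * x⁻¹ ^ k' := by
      have : 0 < 1 - x := by linarith
      rw [inv_pow, inv_pow, ← mul_inv, ← one_div, le_div_iff₀ (by positivity)]
      linarith
    exact_mod_cast h2.trans hS
  · have : 0 ≤ 5 / η := by positivity
    nlinarith
  · have e : η * ((5 / η + 2) * ((k + M).choose k : ℝ)) = (5 + 2 * η) * ((k + M).choose k : ℝ) := by
      field_simp
    rw [e]
    have : 2 * ((k + M).choose k : ℝ) / p ≤ 4 * ((k + M).choose k : ℝ) := by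
      rw [div_le_iff₀ hp0]; nlinarith
    nlinarith


lemma a_bounds (a : ℝ) (ha : 0 < a) (h9 : a ^ 9 = 4) : 1.1665 ≤ a ∧ a ≤ 1.1666 := by
  constructor
  · by_contra h
    push Not at h
    have : a ^ 9 < 1.1665 ^ 9 := by gcongr
    rw [h9] at this; norm_num at this
  · by_contra h
    push Not at h
    have : 1.1666 ^ 9 < a ^ 9 := by gcongr
    rw [h9] at this; norm_num at this

lemma x0_bound (a q : ℝ) (ha1 : 1.1665 ≤ a) (ha2 : a ≤ 1.1666) (hq : 0 < q) (hq5 : q ≤ 1 / 5) :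
    2.112 * q ≤ 1 - (1 - q) * Real.exp (Real.log (1 - a * q) / (1 - q)) := by
  have h1q : 0 < 1 - q := by linarith
  have hz : 0 < 1 - a * q := by nlinarith
  have e : Real.exp (Real.log (1 - a * q) / (1 - q)) = (1 - a * q) * (1 + -(a * q)) ^ (q / (1 - q)) := by
    rw [← sub_eq_add_neg, Real.rpow_def_of_pos hz]
    nth_rewrite 2 [← Real.exp_log hz]
    rw [← Real.exp_add]
    congr 1
    field_simp; ring
  have hs0 : 0 ≤ q / (1 - q) := by positivity
  have hs1 : q / (1 - q) ≤ 1 := by rw [div_le_one h1q]; linarith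
  have hb := rpow_one_add_le_one_add_mul_self (s := -(a * q)) (by linarith) hs0 hs1
  have h2 : (1 - q) * Real.exp (Real.log (1 - a * q) / (1 - q)) ≤ 
      (1 - q) * ((1 - a * q) * (1 + q / (1 - q) * -(a * q))) := by
    rw [e]; gcongr
  have h3 : (1 - q) * ((1 - a * q) * (1 + q / (1 - q) * -(a * q))) = (1 - a * q) * (1 - q - a * q ^ 2) := by
    field_simp; ring
  rw [h3] at h2
  have h4 : 1 - (1 - a * q) * (1 - q - a * q ^ 2) = q * (1 + a - (a * q) ^ 2) := by ring
  have h5 : (a * q) ^ 2 ≤ (1.1666 * (1 / 5)) ^ 2 := by gcongr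
  have h6 : 2.112 ≤ 1 + a - (a * q) ^ 2 := by norm_num at h5 ⊢; linarith
  nlinarith

lemma J_nonneg (a q : ℝ) (ha1 : 1.1665 ≤ a) (ha2 : a ≤ 1.1666) (hq : 0 < q) (hq5 : q ≤ 1 / 5) :
    0 ≤ -q * Real.log q - (1 - q) * Real.log (1 - q) - 2 * q * Real.log a + Real.log (1 - a * q)
      + q * Real.log (1 - (1 - q) * Real.exp (Real.log (1 - a * q) / (1 - q))) := by
  have ha0 : 0 < a := by linarith
  have hx := x0_bound a q ha1 ha2 hq hq5
  have h1 : Real.log 2.112 + Real.log q ≤ 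
      Real.log (1 - (1 - q) * Real.exp (Real.log (1 - a * q) / (1 - q))) := by
    rw [← Real.log_mul (by norm_num) hq.ne']
    exact Real.log_le_log (by positivity) hx
  have h2 : 5 * q * Real.log (1 - a / 5) ≤ Real.log (1 - a * q) := by
    have hcc := strictConcaveOn_log_Ioi.concaveOn.2
    have := hcc (show (1 - a / 5) ∈ Set.Ioi (0 : ℝ) from Set.mem_Ioi.2 (by linarith))
      (show (1 : ℝ) ∈ Set.Ioi (0 : ℝ) from Set.mem_Ioi.2 one_pos)
      (show 0 ≤ 5 * q by linarith) (show 0 ≤ 1 - 5 * q by linarith) (by ring)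
    simp only [smul_eq_mul, Real.log_one, mul_zero, add_zero] at this
    refine this.trans (le_of_eq ?_)
    congr 1; ring
  have h3 : 4 * q * Real.log (5 / 4) ≤ - (1 - q) * Real.log (1 - q) := by
    have hcc := Real.concaveOn_negMulLog.2
    have := hcc (show (4 / 5 : ℝ) ∈ Set.Ici (0 : ℝ) from Set.mem_Ici.2 (by norm_num))
      (show (1 : ℝ) ∈ Set.Ici (0 : ℝ) from Set.mem_Ici.2 zero_le_one)
      (show 0 ≤ 5 * q by linarith) (show 0 ≤ 1 - 5 * q by linarith) (by ring)
    simp only [smul_eq_mul, Real.negMulLog_one, mul_zero, add_zero] at this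
    have e : 5 * q * (4 / 5) + (1 - 5 * q) * 1 = 1 - q := by ring
    rw [e] at this
    simp only [Real.negMulLog] at this
    have e2 : Real.log (4 / 5) = - Real.log (5 / 4) := by rw [← Real.log_inv]; norm_num
    rw [e2] at this
    linarith
  have h4 : 0 ≤ Real.log 2.112 - 2 * Real.log a + 4 * Real.log (5 / 4) + 5 * Real.log (1 - a / 5) := by
    have h15 : 0 < 1 - a / 5 := by linarith
    have e : Real.log (2.112 * (5 / 4) ^ 4 * (1 - a / 5) ^ 5) = 
        Real.log 2.112 + 4 * Real.log (5 / 4) + 5 * Real.log (1 - a / 5) := by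
      rw [Real.log_mul (by norm_num) (by positivity), Real.log_mul (by norm_num) (by norm_num),
        Real.log_pow, Real.log_pow]; norm_num
    have e2 : Real.log (a ^ 2) = 2 * Real.log a := by rw [Real.log_pow]; norm_num
    have : Real.log (a ^ 2) ≤ Real.log (2.112 * (5 / 4) ^ 4 * (1 - a / 5) ^ 5) := by
      apply Real.log_le_log (by positivity)
      have c1 : a ^ 2 ≤ 1.1666 ^ 2 := by gcongr
      have c2 : (1 - 1.1666 / 5) ^ 5 ≤ (1 - a / 5) ^ 5 := by
        gcongr
      have c3 : (1.1666 : ℝ) ^ 2 ≤ 2.112 * (5 / 4) ^ 4 * (1 - 1.1666 / 5) ^ 5 := by norm_num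
      nlinarith
    linarith
  have h5 : 0 ≤ q * (Real.log 2.112 - 2 * Real.log a + 4 * Real.log (5 / 4) + 5 * Real.log (1 - a / 5)) := by
    positivity
  have h6 : q * (Real.log 2.112 + Real.log q) ≤ 
      q * Real.log (1 - (1 - q) * Real.exp (Real.log (1 - a * q) / (1 - q))) := by gcongr
  linarith

lemma fact_pow (m : ℕ) : ∀ i : ℕ, m.factorial * m ^ i ≤ i.factorial * m ^ m := by
  intro i
  rcases le_total m i with h | h
  · have := Nat.factorial_mul_pow_sub_le_factorial h
    calc m.factorial * m ^ i = m.factorial * m ^ (i - m) * m ^ m := by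
          rw [mul_assoc, ← pow_add]; congr 2; omega
      _ ≤ _ := by gcongr
  · have := Nat.factorial_mul_factorial_dvd_factorial h
    have h2 : m.factorial ≤ i.factorial * m ^ (m - i) := by
      have h3 := Nat.factorial_mul_descFactorial (Nat.sub_le m i)
      rw [Nat.sub_sub_self h] at h3
      rw [← h3]
      gcongr
      exact Nat.descFactorial_le_pow _ _
    calc m.factorial * m ^ i ≤ i.factorial * m ^ (m - i) * m ^ i := by gcongr
      _ = _ := by rw [mul_assoc, ← pow_add]; congr 2; omega

lemma choose_lower (k l : ℕ) : (k + l) ^ (k + l) ≤ (k + l + 1) * ((k + l).choose l * (l ^ l * k ^ k)) := by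
  rw [add_comm k l, add_pow]
  have : ∀ i ∈ Finset.range (l + k + 1), l ^ i * k ^ (l + k - i) * (l + k).choose i ≤ 
      (l + k).choose l * (l ^ l * k ^ k) := by
    intro i hi
    have hi' : i ≤ l + k := by rw [Finset.mem_range] at hi; omega
    have f1 := fact_pow l i
    have f2 := fact_pow k (l + k - i)
    have c1 := Nat.choose_mul_factorial_mul_factorial hi'
    have c2 := Nat.choose_mul_factorial_mul_factorial (Nat.le_add_right l k)
    rw [Nat.add_sub_cancel_left] at c2
    have hpos : 0 < l.factorial * k.factorial * (i.factorial * (l + k - i).factorial) := by positivity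
    refine Nat.le_of_mul_le_mul_left ?_ hpos
    calc l.factorial * k.factorial * (i.factorial * (l + k - i).factorial) * 
          (l ^ i * k ^ (l + k - i) * (l + k).choose i)
        = (l.factorial * l ^ i) * (k.factorial * k ^ (l + k - i)) * 
          ((l + k).choose i * i.factorial * (l + k - i).factorial) := by ring
      _ ≤ (i.factorial * l ^ l) * ((l + k - i).factorial * k ^ k) * 
          ((l + k).choose i * i.factorial * (l + k - i).factorial) := by gcongr
      _ = (i.factorial * l ^ l) * ((l + k - i).factorial * k ^ k) * 
          ((l + k).choose l * l.factorial * k.factorial) := by rw [c1, c2]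
      _ = _ := by ring
  have := Finset.sum_le_card_nsmul _ _ _ this
  simpa using this

lemma log_choose_lower (k l : ℕ) (hk : 0 < k) (hl : 0 < l) (q : ℝ) (hq : q = l / (k + l)) :
    -l * Real.log q - k * Real.log (1 - q) - Real.log (k + l + 1) ≤ Real.log ((k + l).choose l) := by
  have h := choose_lower k l
  have hk' : (0 : ℝ) < k := by exact_mod_cast hk
  have hl' : (0 : ℝ) < l := by exact_mod_cast hl
  have hC : (0 : ℝ) < (k + l).choose l := by exact_mod_cast Nat.choose_pos (by omega)
  have h' : ((k + l : ℝ)) ^ (k + l) ≤ (k + l + 1) * ((k + l).choose l * ((l : ℝ) ^ l * (k : ℝ) ^ k)) := by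
    exact_mod_cast h
  have h2 := Real.log_le_log (by positivity) h'
  rw [Real.log_mul (by positivity) (by positivity), Real.log_mul (by positivity) (by positivity),
    Real.log_mul (by positivity) (by positivity), Real.log_pow, Real.log_pow, Real.log_pow] at h2
  have e1 : Real.log q = Real.log l - Real.log (k + l) := by
    rw [hq, Real.log_div (by positivity) (by positivity)]
  have e2 : Real.log (1 - q) = Real.log k - Real.log (k + l) := by
    have : 1 - q = k / (k + l) := by rw [hq]; field_simp; ring
    rw [this, Real.log_div (by positivity) (by positivity)]
  rw [e1, e2]
  push_cast at h2
  linarith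

lemma eventually_small (ε : ℝ) (hε : 0 < ε) (M : ℕ) (C : ℝ) :
    ∃ k0 : ℕ, ∀ k : ℕ, k0 ≤ k → C + Real.log ((k + M).choose k) + 2 * Real.log (2 * k + 1) ≤ ε * k := by
  have h1 := Real.isLittleO_log_id_atTop.def (c := ε / (2 * (M + 2))) (by positivity)
  have h2 := h1.natCast_atTop
  obtain ⟨k1, hk1⟩ := Filter.eventually_atTop.1 h2
  obtain ⟨k2, hk2⟩ := exists_nat_ge ((C + (M + 4) * Real.log 4) / (ε / 2))
  refine ⟨max (max k1 k2) (M + 1), fun k hk => ?_⟩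
  have hkk1 : k1 ≤ k := by omega
  have hkk2 : (k2 : ℝ) ≤ k := by exact_mod_cast (by omega : k2 ≤ k)
  have hkM : M + 1 ≤ k := by omega
  have hk0 : (0 : ℝ) < k := by exact_mod_cast (by omega : 0 < k)
  have hk1' : (1 : ℝ) ≤ k := by exact_mod_cast (by omega : 1 ≤ k)
  have a1 := hk1 k hkk1
  simp only [id, Real.norm_eq_abs] at a1
  rw [abs_of_nonneg (Real.log_nonneg hk1'), abs_of_pos hk0] at a1
  have a2 : Real.log ((k + M).choose k) ≤ M * (Real.log 4 + Real.log k) := by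
    have b1 : (k + M).choose k ≤ (k + M) ^ M := by
      rw [Nat.choose_symm_add]; exact Nat.choose_le_pow _ _
    have b2 : ((k + M).choose k : ℝ) ≤ ((4 : ℝ) * k) ^ M := by
      have : ((k + M).choose k : ℝ) ≤ ((k + M : ℕ) : ℝ) ^ M := by exact_mod_cast b1
      refine this.trans ?_
      gcongr
      have : k + M ≤ 4 * k := by omega
      exact_mod_cast this
    have hC : (0 : ℝ) < (k + M).choose k := by exact_mod_cast Nat.choose_pos (by omega)
    have := Real.log_le_log hC b2
    rwa [Real.log_pow, Real.log_mul (by norm_num) hk0.ne'] at this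
  have a3 : Real.log (2 * k + 1) ≤ Real.log 4 + Real.log k := by
    rw [← Real.log_mul (by norm_num) hk0.ne']
    apply Real.log_le_log (by positivity); linarith
  have a4 : (M + 2) * Real.log k ≤ ε / 2 * k := by
    calc (M + 2) * Real.log k ≤ (M + 2) * (ε / (2 * (M + 2)) * k) := by gcongr
      _ = _ := by field_simp
  have a5 : C + (M + 4) * Real.log 4 ≤ ε / 2 * k := by
    have := hk2.trans hkk2
    rw [div_le_iff₀ (by positivity)] at this
    linarith
  have a6 : 0 ≤ Real.log 4 := Real.log_nonneg (by norm_num)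
  linarith


lemma final_numeric (ε σ τ a q c0 x p N : ℝ) (J M k l : ℕ) (ha9 : Real.log a = 2 / 9 * Real.log 2)
    (ha1 : 1.1665 ≤ a) (ha2 : a ≤ 1.1666) (hε : 0 < ε) (hσ0 : 0 < σ) (hσ : σ ≤ ε / 10) (hτ0 : 0 < τ)
    (hτ : τ ≤ ε / 10) (hτ1 : τ ≤ 0.01) (hc0 : 0 < c0) (hk : 0 < k) (hl : 0 < l) (hlk : (l : ℝ) ≤ k / 4)
    (hq : q = l / (k + l)) (hp : p = 1 - a * q - 2 * τ)
    (hx : x = (1 - q) * Real.exp (-σ + Real.log p / (1 - q)))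
    (hN : (2 : ℝ) ^ (-(2 / 9) * (l : ℝ) + ε * k) * ((k + l).choose l : ℝ) / 2 ≤ N)
    (hsm : (Real.log c0 - (J + 1) * Real.log τ + 2 * Real.log 2) + Real.log ((k + M).choose k)
      + 2 * Real.log (2 * k + 1) ≤ ε / 2 * k) :
    c0 * ((k + M).choose k : ℝ) * (1 - x)⁻¹ ^ l * x⁻¹ ^ k * (q * Real.exp (-σ))⁻¹ ^ l ≤ τ ^ (J + 1) * (N * N) := by
  have hk' : (0 : ℝ) < k := by exact_mod_cast hk
  have hl' : (0 : ℝ) < l := by exact_mod_cast hl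
  have hn : (0 : ℝ) < k + l := by positivity
  have hq0 : 0 < q := by rw [hq]; positivity
  have hq5 : q ≤ 1 / 5 := by rw [hq, div_le_iff₀ hn]; linarith
  have hnq : (k + l) * q = l := by rw [hq]; field_simp
  have h1q : 0 < 1 - q := by linarith
  have hkq : (k : ℝ) = (k + l) * (1 - q) := by linarith
  have haq : a * q ≤ 1.1666 * (1 / 5) := by gcongr
  have hp7 : 7 / 10 ≤ p := by rw [hp]; norm_num at haq ⊢; linarith
  have hz : 0 < 1 - a * q := by norm_num at haq; linarith
  have hp0 : 0 < p := by linarith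
  have hpz : p ≤ 1 - a * q := by linarith
  have hlogp : Real.log (1 - a * q) - 4 * τ ≤ Real.log p := by
    have := Real.log_le_sub_one_of_pos (show 0 < (1 - a * q) / p by positivity)
    rw [Real.log_div hz.ne' hp0.ne'] at this
    have h2 : (1 - a * q) / p - 1 ≤ 4 * τ := by
      rw [sub_le_iff_le_add, div_le_iff₀ hp0]
      nlinarith
    linarith
  have hx0 : 0 < x := by rw [hx]; positivity
  have hxx : x ≤ (1 - q) * Real.exp (Real.log (1 - a * q) / (1 - q)) := by
    rw [hx]
    have : Real.log p / (1 - q) ≤ Real.log (1 - a * q) / (1 - q) := by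
      gcongr
    gcongr; linarith
  have hb := x0_bound a q ha1 ha2 hq0 hq5
  have hx1 : 0 < 1 - (1 - q) * Real.exp (Real.log (1 - a * q) / (1 - q)) := by
    have : 0 < 2.112 * q := by positivity
    linarith
  have hJ := J_nonneg a q ha1 ha2 hq0 hq5
  have hJn := mul_nonneg hn.le hJ
  have hlog1x : Real.log (1 - (1 - q) * Real.exp (Real.log (1 - a * q) / (1 - q))) ≤ Real.log (1 - x) :=
    Real.log_le_log hx1 (by linarith)
  have h1x : 0 < 1 - x := by linarith
  have hlogx : Real.log x = Real.log (1 - q) - σ + Real.log p / (1 - q) := by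
    rw [hx, Real.log_mul h1q.ne' (Real.exp_ne_zero _), Real.log_exp]; ring
  have hC : (0 : ℝ) < (k + l).choose l := by exact_mod_cast Nat.choose_pos (by omega)
  have hCM : (0 : ℝ) < (k + M).choose k := by exact_mod_cast Nat.choose_pos (by omega)
  have hlogC := log_choose_lower k l hk hl q hq
  have hN0 : 0 < N := lt_of_lt_of_le (by positivity) hN
  have hlogN : (-(2 / 9) * (l : ℝ) + ε * k) * Real.log 2 + Real.log ((k + l).choose l) - Real.log 2 ≤ Real.log N := by
    have := Real.log_le_log (by positivity) hN
    rwa [Real.log_div (by positivity) (by norm_num), Real.log_mul (by positivity) hC.ne', Real.log_rpow (by norm_num)] at this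
  rw [← Real.log_le_log_iff (by positivity) (by positivity)]
  rw [Real.log_mul (by positivity) (by positivity), Real.log_mul (by positivity) (by positivity),
    Real.log_mul (by positivity) (by positivity), Real.log_mul (by positivity) (by positivity),
    Real.log_mul (by positivity) (by positivity), Real.log_mul (by positivity) (by positivity),
    Real.log_pow, Real.log_pow, Real.log_pow, Real.log_pow, Real.log_inv, Real.log_inv, Real.log_inv,
    Real.log_mul (by positivity) (by positivity), Real.log_exp, hlogx]
  have e1 : (k : ℝ) * (Real.log p / (1 - q)) = (k + l) * Real.log p := by
    rw [hkq]; field_simp; rw [← hkq]; ring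
  have e2 : (k + l) * (Real.log (1 - a * q) - 4 * τ) ≤ (k + l) * Real.log p := by gcongr
  have e3 : (l : ℝ) * Real.log (1 - (1 - q) * Real.exp (Real.log (1 - a * q) / (1 - q))) ≤ l * Real.log (1 - x) := by
    gcongr
  have e4 : Real.log (k + l + 1) ≤ Real.log (2 * k + 1) := Real.log_le_log (by positivity) (by linarith)
  have e5 : (k + l) * σ ≤ 1.25 * k * (ε / 10) := by gcongr; linarith
  have e6 : (k + l) * τ ≤ 1.25 * k * (ε / 10) := by gcongr; linarith
  have e7 : 0.69 * (ε * k) ≤ Real.log 2 * (ε * k) := by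
    have := Real.log_two_gt_d9
    gcongr; linarith
  generalize Real.log (1 - (1 - q) * Real.exp (Real.log (1 - a * q) / (1 - q))) = L1 at *
  have e8 : (k + l) * (-q * Real.log q - (1 - q) * Real.log (1 - q) - 2 * q * Real.log a + Real.log (1 - a * q)
      + q * L1) = -l * Real.log q - k * Real.log (1 - q) - 2 * l * (2 / 9 * Real.log 2) +
        (k + l) * Real.log (1 - a * q) + l * L1 := by
    rw [← ha9]
    linear_combination (-Real.log q - 2 * Real.log a + L1 + Real.log (1 - q)) * hnq
  rw [e8] at hJn
  have hek : 0 < ε * k := by positivity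
  push_cast
  have e9 : (k : ℝ) * (Real.log (1 - q) - σ + Real.log p / (1 - q)) = k * Real.log (1 - q) - k * σ + (k + l) * Real.log p := by
    rw [← e1]; ring
  norm_num at *
  linarith

lemma two_pow_le_choose (k : ℕ) : ∀ l : ℕ, l ≤ k → 2 ^ l ≤ (k + l).choose l := by
  intro l
  induction l with
  | zero => simp
  | succ l ih =>
    intro h
    have h1 := ih (by omega)
    have h2 := Nat.add_one_mul_choose_eq (k + l) l
    have h3 : (2 * (l + 1)) * 2 ^ l ≤ (k + l + 1) * (k + l).choose l := by
      apply Nat.mul_le_mul _ h1; omega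
    rw [h2] at h3
    refine Nat.le_of_mul_le_mul_right ?_ (show 0 < l + 1 by omega)
    rw [← add_assoc]
    calc _ = _ := by ring
      _ ≤ _ := h3

theorem ramsey_claim (ε : ℝ) (hε : 0 < ε) :
    ∃ k₀ : ℕ, ∀ k : ℕ, k₀ ≤ k → ∀ (V : Type) [DecidableEq V] (c : V → V → Bool), (∀ v w, c v w = c w v) →
      ∀ l : ℕ, (l : ℝ) ≤ (k : ℝ) / 4 → ∀ S : Finset V,
      ⌊(2 : ℝ) ^ (-(2 / 9) * (l : ℝ) + ε * k) * ((k + l).choose l : ℝ)⌋₊ ≤ S.card →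
      MCl c true k S ∨ MCl c false l S := by
  set σ := min (1 / 2) (ε / 10) with hσ
  set τ := min 0.01 (ε / 10) with hτ
  have hσ0 : 0 < σ := by rw [hσ]; positivity
  have hτ0 : 0 < τ := by rw [hτ]; apply lt_min; norm_num; positivity
  have hσ1 : σ ≤ ε / 10 := min_le_right _ _
  have hσ2 : σ ≤ 1 / 2 := min_le_left _ _
  have hτ1 : τ ≤ ε / 10 := min_le_right _ _
  have hτ2 : τ ≤ 0.01 := min_le_left _ _
  clear_value σ τ
  obtain ⟨J, M, c0, hc0, hbook⟩ := book_thm σ (3 * ε) hσ0 (by linarith) (by positivity)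
  obtain ⟨k1, hk1⟩ := eventually_small (ε / 2) (by positivity) M (Real.log c0 - (J + 1) * Real.log τ + 2 * Real.log 2)
  obtain ⟨k2, hk2⟩ := exists_nat_ge (12 / (τ * ε))
  obtain ⟨a, ha, ha9, hala⟩ : ∃ a : ℝ, a = (2 : ℝ) ^ (2 / 9 : ℝ) ∧ a ^ 9 = 4 ∧ Real.log a = 2 / 9 * Real.log 2 := by
    refine ⟨_, rfl, ?_, ?_⟩
    · rw [← Real.rpow_natCast, ← Real.rpow_mul (by norm_num)]; norm_num
    · rw [Real.log_rpow (by norm_num)]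
  have ha0 : 0 < a := by rw [ha]; positivity
  obtain ⟨ha1, ha2⟩ := a_bounds a ha0 ha9
  refine ⟨max (max k1 k2) 1, fun k hk V _ c hc l => ?_⟩
  have hkk1 : k1 ≤ k := by omega
  have hkk2 : (k2 : ℝ) ≤ k := by exact_mod_cast (by omega : k2 ≤ k)
  have hkp : 0 < k := by omega
  have hk0 : (0 : ℝ) < k := by exact_mod_cast hkp
  have hsm := hk1 k hkk1
  have hkτ : 12 / τ ≤ ε * k := by
    have := hk2.trans hkk2
    rw [div_le_iff₀ (by positivity)] at this
    rw [div_le_iff₀ hτ0]; linarith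
  induction l with
  | zero => intro _ S _; exact Or.inr (MCl.zero c false S)
  | succ l ih =>
    intro hlk S hS
    by_cases hcase : (2 / 9) * ((l + 1 : ℕ) : ℝ) ≤ ε * k
    · have : (k + (l + 1)).choose k ≤ S.card := by
        refine le_trans ?_ hS
        apply Nat.le_floor
        rw [Nat.choose_symm_add]
        refine le_mul_of_one_le_left (by positivity) ?_
        apply Real.one_le_rpow (by norm_num)
        linarith
      exact erdos_szekeres hc _ k (l + 1) rfl S this
    push Not at hcase
    have hl0 : (0 : ℝ) < ((l + 1 : ℕ) : ℝ) := by positivity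
    obtain ⟨q, hq⟩ : ∃ q : ℝ, q = ((l + 1 : ℕ) : ℝ) / (k + ((l + 1 : ℕ) : ℝ)) := ⟨_, rfl⟩
    have hn : (0 : ℝ) < k + ((l + 1 : ℕ) : ℝ) := by positivity
    have hq0 : 0 < q := by rw [hq]; positivity
    have hq5 : q ≤ 1 / 5 := by rw [hq, div_le_iff₀ hn]; linarith
    have hqε : 3 * ε ≤ q := by
      rw [hq, le_div_iff₀ hn]
      nlinarith
    have hrec : (2 : ℝ) ^ (-(2 / 9) * (l : ℝ) + ε * k) * ((k + l).choose l : ℝ) = 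
        a * q * ((2 : ℝ) ^ (-(2 / 9) * ((l + 1 : ℕ) : ℝ) + ε * k) * ((k + (l + 1)).choose (l + 1) : ℝ)) := by
      have h2 := Nat.add_one_mul_choose_eq (k + l) l
      have h3 : (k + ((l + 1 : ℕ) : ℝ)) * ((k + l).choose l : ℝ) = ((k + (l + 1)).choose (l + 1) : ℝ) * ((l + 1 : ℕ) : ℝ) := by
        exact_mod_cast h2
      have h4 : (2 : ℝ) ^ (-(2 / 9) * (l : ℝ) + ε * k) = a * (2 : ℝ) ^ (-(2 / 9) * ((l + 1 : ℕ) : ℝ) + ε * k) := by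
        rw [ha, ← Real.rpow_add (by norm_num)]
        congr 1; push_cast; ring
      have h5 : ((k + l).choose l : ℝ) = q * ((k + (l + 1)).choose (l + 1) : ℝ) := by
        rw [hq, div_mul_eq_mul_div, eq_div_iff hn.ne']; linarith
      rw [h4, h5]; ring
    obtain ⟨T, hT⟩ : ∃ T, T = (2 : ℝ) ^ (-(2 / 9) * ((l + 1 : ℕ) : ℝ) + ε * k) * ((k + (l + 1)).choose (l + 1) : ℝ) := ⟨_, rfl⟩
    rw [← hT] at hS hrec
    have hTk : 6 / τ ≤ T := by
      have h1 : ((2 : ℝ) ^ (((l + 1 : ℕ) : ℝ))) ≤ ((k + (l + 1)).choose (l + 1) : ℝ) := by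
        rw [Real.rpow_natCast]
        have h3 : l + 1 ≤ k := by
          have : ((l + 1 : ℕ) : ℝ) ≤ k := by linarith
          exact_mod_cast this
        exact_mod_cast two_pow_le_choose k (l + 1) h3
      have h2 : (2 : ℝ) ^ (ε * k) ≤ T := by
        rw [hT]
        calc (2 : ℝ) ^ (ε * k) ≤ (2 : ℝ) ^ (-(2 / 9) * ((l + 1 : ℕ) : ℝ) + ε * k + ((l + 1 : ℕ) : ℝ)) := by
              apply Real.rpow_le_rpow_of_exponent_le (by norm_num); linarith
          _ = (2 : ℝ) ^ (-(2 / 9) * ((l + 1 : ℕ) : ℝ) + ε * k) * (2 : ℝ) ^ (((l + 1 : ℕ) : ℝ)) := by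
              rw [Real.rpow_add (by norm_num)]
          _ ≤ _ := by gcongr
      have h3 : Real.log 2 * (ε * k) + 1 ≤ (2 : ℝ) ^ (ε * k) := by
        rw [Real.rpow_def_of_pos (by norm_num)]; exact Real.add_one_le_exp _
      have h4 : 1 / 2 * (ε * k) ≤ Real.log 2 * (ε * k) := by
        have := Real.log_two_gt_d9
        gcongr; linarith
      have h5 : 6 / τ = 1 / 2 * (12 / τ) := by ring
      linarith
    have hT2 : 2 ≤ T := by
      refine le_trans ?_ hTk
      rw [le_div_iff₀ hτ0]; linarith
    have hTN : T < S.card + 1 := by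
      have := Nat.lt_floor_add_one T
      have h2 : (⌊T⌋₊ : ℝ) ≤ S.card := by exact_mod_cast hS
      linarith
    have hτN : 3 ≤ τ * S.card := by
      have h1 : 6 / τ / 2 ≤ S.card := by linarith
      rw [div_div, div_le_iff₀ (by positivity)] at h1
      linarith
    have hN0 : (0 : ℝ) < S.card := by linarith
    by_cases hv : ∃ v ∈ S, ⌊(2 : ℝ) ^ (-(2 / 9) * (l : ℝ) + ε * k) * ((k + l).choose l : ℝ)⌋₊ ≤ (MN c false v S).card
    · obtain ⟨v, hvS, hv⟩ := hv
      have hlk' : (l : ℝ) ≤ k / 4 := by push_cast at hlk; linarith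
      rcases ih hlk' _ hv with h | h
      · exact Or.inl (h.mono (MN_subset _ _ _))
      · refine Or.inr (MCl.cons hc hvS (MN_subset _ _ _) ?_ h)
        intro z hz
        exact (mem_MN.1 hz).2
    push Not at hv
    obtain ⟨p, hp⟩ : ∃ p, p = 1 - a * q - 2 * τ := ⟨_, rfl⟩
    have haq : a * q ≤ 1.1666 * (1 / 5) := by gcongr
    have haq0 : 0 < a * q := by positivity
    have hexc : τ * (S.card * S.card) ≤ exc c p S S := by
      have : ∀ v ∈ S, τ * S.card ≤ ((MN c true v S).card - p * S.card : ℝ) := by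
        intro v hvS
        have h1 := hv v hvS
        rw [hrec] at h1
        have h2 : ((MN c false v S).card : ℝ) ≤ a * q * T := by
          refine le_trans ?_ (Nat.floor_le (by positivity : 0 ≤ a * q * T))
          exact_mod_cast h1.le
        have h3 : ((MN c true v S).card : ℝ) + (MN c false v S).card + 1 = S.card := by
          exact_mod_cast MN_card_add hvS
        have h4 : a * q * T ≤ a * q * (S.card + 1) := by gcongr
        rw [hp]
        norm_num at haq
        linarith
      have h2 := Finset.card_nsmul_le_sum _ _ _ this
      rw [nsmul_eq_mul] at h2
      unfold exc
      linarith
    have hp7 : 7 / 10 ≤ p := by rw [hp]; norm_num at haq hτ2 ⊢; linarith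
    refine hbook V c hc p q hp7 (by linarith) hqε (by linarith) _ rfl k (l + 1) S
      (lt_of_lt_of_le (by positivity) hexc) ?_
    have hfin := final_numeric ε σ τ a q c0 _ p S.card J M k (l + 1) hala ha1 ha2 hε hσ0 hσ1 hτ0 hτ1 hτ2 hc0
      hkp (by omega) hlk hq hp rfl (by rw [← hT]; linarith) hsm
    refine le_trans ?_ (pow_le_pow_left₀ (by positivity) hexc (J + 1))
    calc _ ≤ τ ^ (J + 1) * ((S.card : ℝ) * S.card) * ((S.card : ℝ) * S.card) ^ J := by gcongr
      _ = _ := by ring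


theorem ramseyOff_exponential_improvement (ε : ℝ) (hε : 0 < ε) :
    ∃ k₀ : ℕ, ∀ k : ℕ, k₀ ≤ k → ∀ l : ℕ, 2 ≤ l → (l : ℝ) ≤ (k : ℝ) / 4 →
      (ramseyOff k l : ℝ) ≤
        (2 : ℝ) ^ (-(2 / 9) * (l : ℝ) + ε * k) * ((k + l).choose l : ℝ) := by
  obtain ⟨k₀, h⟩ := ramsey_claim ε hε
  refine ⟨k₀, fun k hk l _ hlk => ?_⟩
  refine le_trans ?_ (Nat.floor_le (by positivity))
  norm_cast
  apply Nat.sInf_le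
  intro c hc
  rcases h k hk _ c hc l hlk Finset.univ (by simp) with ⟨T, _, h1, h2⟩ | ⟨T, _, h1, h2⟩
  · exact Or.inl ⟨T, h1, h2⟩
  · exact Or.inr ⟨T, h1, h2⟩
end

section
/- For every ε > 0 there exists k₀ such that for all integers k ≥ k₀, the diagonal Ramsey number satisfies r(k) ≤ 2^{(2 - 3/200 + ε)k}. -/
namespace Book

set_option linter.unusedSectionVars false

variable {V : Type*} [DecidableEq V]

/-- vertices of `S` joined to `v` in colour `b` -/
def nb (c : V → V → Bool) (b : Bool) (v : V) (S : Finset V) : Finset V :=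
  S.filter (fun w => w ≠ v ∧ c v w = b)

/-- monochromatic clique of colour `b` -/
def Clq (c : V → V → Bool) (b : Bool) (S : Finset V) : Prop :=
  ∀ v ∈ S, ∀ w ∈ S, v ≠ w → c v w = b

/-- `S` has no clique of colour `b` of size `k` -/
def Free (c : V → V → Bool) (b : Bool) (k : ℕ) (S : Finset V) : Prop :=
  ∀ T ⊆ S, Clq c b T → T.card < k

lemma Free.mono {c : V → V → Bool} {b : Bool} {k : ℕ} {S S' : Finset V}
    (h : Free c b k S) (hs : S' ⊆ S) : Free c b k S' :=
  fun T hT => h T (hT.trans hs)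

lemma Free.pos {c : V → V → Bool} {b : Bool} {k : ℕ} {S : Finset V}
    (h : Free c b k S) : 0 < k :=
  (Nat.zero_le _).trans_lt (h ∅ (Finset.empty_subset _) (by intro v hv; simp at hv))

lemma nb_subset (c : V → V → Bool) (b : Bool) (v : V) (S : Finset V) : nb c b v S ⊆ S :=
  Finset.filter_subset _ _

lemma mem_nb {c : V → V → Bool} {b : Bool} {v w : V} {S : Finset V} :
    w ∈ nb c b v S ↔ w ∈ S ∧ w ≠ v ∧ c v w = b := by
  simp [nb]

lemma Free.step {c : V → V → Bool} (hc : ∀ v w, c v w = c w v) {b : Bool} {k : ℕ}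
    {S S' : Finset V} {v : V} (h : Free c b k S) (hv : v ∈ S) (hS' : S' ⊆ S)
    (h' : ∀ w ∈ S', w ≠ v ∧ c v w = b) : Free c b (k - 1) S' := by
  intro T hT hcl
  have hvT : v ∉ T := fun hh => (h' v (hT hh)).1 rfl
  have := h (insert v T) (by
    intro x hx
    rcases Finset.mem_insert.1 hx with rfl | hx
    · exact hv
    · exact hS' (hT hx)) (by
    intro x hx y hy hxy
    rcases Finset.mem_insert.1 hx with rfl | hx
    · rcases Finset.mem_insert.1 hy with rfl | hy
      · exact absurd rfl hxy
      · exact (h' y (hT hy)).2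
    · rcases Finset.mem_insert.1 hy with hy' | hy
      · rw [hy', hc]; exact (h' x (hT (by assumption))).2
      · exact hcl x (by assumption) y hy hxy)
  rw [Finset.card_insert_of_notMem hvT] at this
  omega

lemma card_split (c : V → V → Bool) (v : V) (S : Finset V) (hv : v ∈ S) :
    (nb c true v S).card + (nb c false v S).card + 1 = S.card := by
  have h1 : S = insert v (nb c true v S ∪ nb c false v S) := by
    ext w
    simp only [Finset.mem_insert, Finset.mem_union, mem_nb]
    constructor
    · intro hw
      by_cases h : w = v
      · exact Or.inl h
      · cases hcv : c v w <;> simp [h, hw]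
    · rintro (rfl | h | h)
      · exact hv
      · exact h.1
      · exact h.1
  have hd : Disjoint (nb c true v S) (nb c false v S) := by
    rw [Finset.disjoint_left]
    intro w h1 h2
    exact Bool.noConfusion ((mem_nb.1 h1).2.2.symm.trans (mem_nb.1 h2).2.2)
  have hn : v ∉ nb c true v S ∪ nb c false v S := by
    simp [mem_nb]
  conv_rhs => rw [h1]
  rw [Finset.card_insert_of_notMem hn, Finset.card_union_of_disjoint hd]

lemma sum_split (c : V → V → Bool) (v : V) (S : Finset V) (hv : v ∈ S) (f : V → ℝ) :
    ∑ x ∈ S, f x = ∑ x ∈ nb c true v S, f x + ∑ x ∈ nb c false v S, f x + f v := by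
  have h1 : S = insert v (nb c true v S ∪ nb c false v S) := by
    ext w
    simp only [Finset.mem_insert, Finset.mem_union, mem_nb]
    constructor
    · intro hw
      by_cases h : w = v
      · exact Or.inl h
      · cases hcv : c v w <;> simp [h, hw]
    · rintro (rfl | h | h)
      · exact hv
      · exact h.1
      · exact h.1
  have hd : Disjoint (nb c true v S) (nb c false v S) := by
    rw [Finset.disjoint_left]
    intro w h1 h2
    exact Bool.noConfusion ((mem_nb.1 h1).2.2.symm.trans (mem_nb.1 h2).2.2)
  have hn : v ∉ nb c true v S ∪ nb c false v S := by
    simp [mem_nb]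
  conv_lhs => rw [h1]
  rw [Finset.sum_insert hn, Finset.sum_union hd]
  ring

/-- Erdős–Szekeres -/
lemma es {c : V → V → Bool} (hc : ∀ v w, c v w = c w v) {u : ℝ} (h0 : 0 < u) (h1 : u < 1) :
    ∀ (N : ℕ) (S : Finset V) (k l : ℕ), S.card = N → Free c true k S → Free c false l S →
      ((S.card : ℝ) + 1) * (u ^ k * (1 - u) ^ l) ≤ 1 := by
  intro N
  induction N using Nat.strong_induction_on with
  | _ N ih =>
  intro S k l hN hk hl
  have h1u : 0 < 1 - u := by linarith
  rcases S.eq_empty_or_nonempty with rfl | ⟨v, hv⟩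
  · have ha : u ^ k ≤ 1 := pow_le_one₀ h0.le h1.le
    have hb : (1 - u) ^ l ≤ 1 := pow_le_one₀ h1u.le (by linarith)
    simp only [Finset.card_empty, Nat.cast_zero, zero_add, one_mul]
    exact mul_le_one₀ ha (by positivity) hb
  have hsp := card_split c v S hv
  have hkp := hk.pos
  have hlp := hl.pos
  obtain ⟨k, rfl⟩ : ∃ k', k = k' + 1 := ⟨k - 1, by omega⟩
  obtain ⟨l, rfl⟩ : ∃ k', l = k' + 1 := ⟨l - 1, by omega⟩
  have e1 := ih _ (by omega) (nb c true v S) k (l + 1) rfl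
    (by simpa using hk.step hc hv (nb_subset c true v S) (fun w hw => (mem_nb.1 hw).2))
    (hl.mono (nb_subset _ _ _ _))
  have e2 := ih _ (by omega) (nb c false v S) (k + 1) l rfl
    (hk.mono (nb_subset _ _ _ _))
    (by simpa using hl.step hc hv (nb_subset c false v S) (fun w hw => (mem_nb.1 hw).2))
  have hS : (S.card : ℝ) = (nb c true v S).card + (nb c false v S).card + 1 := by
    exact_mod_cast hsp.symm
  rw [hS]
  have e1' := mul_le_mul_of_nonneg_left e1 h0.le
  have e2' := mul_le_mul_of_nonneg_left e2 h1u.le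
  have : ((nb c true v S).card + (nb c false v S).card + 1 + 1 : ℝ) * (u ^ (k + 1) * (1 - u) ^ (l + 1))
    = u * (((nb c true v S).card + 1) * (u ^ k * (1 - u) ^ (l + 1))) +
      (1 - u) * (((nb c false v S).card + 1) * (u ^ (k + 1) * (1 - u) ^ l)) := by ring
  rw [this]
  linarith

/-- weighted AM-GM -/
lemma amgm (n : ℕ) {a b : ℝ} (ha : 0 ≤ a) (hb : 0 ≤ b) :
    a ^ n * b ^ 3 ≤ ((n * a + 3 * b) / (n + 3)) ^ (n + 3) := by
  have hn : (0:ℝ) < n + 3 := by positivity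
  have h := Real.geom_mean_le_arith_mean2_weighted (w₁ := n / (n + 3)) (w₂ := 3 / (n + 3))
    (p₁ := a) (p₂ := b) (by positivity) (by positivity) ha hb (by field_simp)
  have h2 := pow_le_pow_left₀ (by positivity) h (n + 3)
  have e1 : (a ^ ((n:ℝ) / (n + 3))) ^ (n + 3) = a ^ n := by
    rw [← Real.rpow_natCast, ← Real.rpow_mul ha, ← Real.rpow_natCast]
    congr 1
    push_cast
    field_simp
  have e2 : (b ^ ((3:ℝ) / (n + 3))) ^ (n + 3) = b ^ 3 := by
    rw [← Real.rpow_natCast, ← Real.rpow_mul hb, ← Real.rpow_natCast]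
    congr 1
    push_cast
    field_simp
  rw [mul_pow, e1, e2] at h2
  refine h2.trans_eq ?_
  congr 1
  field_simp

lemma removal (n : ℕ) (hn : 3 ≤ n) {x : ℝ} (h0 : 0 ≤ x) (h1 : x ≤ 1) :
    (1 - x) ^ n ≤ (1 - x / 2) ^ (n + 3) := by
  calc (1 - x) ^ n ≤ ((1 - x / 2) ^ 2) ^ n := by
        apply pow_le_pow_left₀ (by linarith); nlinarith [sq_nonneg x]
    _ = (1 - x / 2) ^ (2 * n) := by rw [← pow_mul]
    _ ≤ _ := pow_le_pow_of_le_one (by linarith) (by linarith) (by omega)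

/-- blue book -/
lemma blue_book {μ μ1 : ℝ} (hμ : 0 ≤ μ) (hμ1 : 0 ≤ μ1) (r : V → V → Prop) [∀ a b, Decidable (r a b)]
    (Q X : Finset V) (m : ℕ) (hm : 1 ≤ m) (hmQ : m ≤ Q.card)
    (hM : μ1 ^ m * (Q.card : ℝ) ^ m ≤ μ ^ m * (Q.card : ℝ) ^ m - (Q.card : ℝ) ^ m
      + (Q.card.descFactorial m : ℝ))
    (h : ∀ q ∈ Q, μ * X.card ≤ ((X.filter (fun x => r q x)).card : ℝ)) :
    ∃ S ⊆ Q, S.card = m ∧ μ1 ^ m * X.card ≤ ((X.filter (fun x => ∀ s ∈ S, r s x)).card : ℝ) := by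
  classical
  let F := Fin m → {q // q ∈ Q}
  let t : F → ℝ := fun f => ((X.filter (fun x => ∀ i, r (f i) x)).card : ℝ)
  have hcF : (Fintype.card F : ℝ) = (Q.card : ℝ) ^ m := by
    simp [F]
  let I : Finset F := Finset.univ.filter (fun f => Function.Injective f)
  have hcI : I.card = Q.card.descFactorial m := by
    have h1 : Fintype.card {f : F // Function.Injective f} = Q.card.descFactorial m := by
      rw [Fintype.card_congr (Equiv.subtypeInjectiveEquivEmbedding _ _), Fintype.card_embedding_eq]
      simp
    rw [← h1, Fintype.card_subtype]
  have hd : ∀ x : V, ((∑ q : {q // q ∈ Q}, if r q x then (1:ℝ) else 0)) ^ m =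
      ∑ f : F, ∏ i, (if r (f i) x then (1:ℝ) else 0) := by
    intro x
    have := Finset.prod_univ_sum (fun _ : Fin m => (Finset.univ : Finset {q // q ∈ Q}))
      (fun _ q => if r q x then (1:ℝ) else 0)
    rw [Finset.prod_const, Finset.card_univ, Fintype.card_fin] at this
    rw [this, Fintype.piFinset_univ]
  have ht : ∑ f : F, t f = ∑ x ∈ X, (∑ q : {q // q ∈ Q}, if r q x then (1:ℝ) else 0) ^ m := by
    simp_rw [hd]
    rw [Finset.sum_comm]
    apply Finset.sum_congr rfl
    intro f _
    simp only [t]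
    rw [Finset.card_filter]
    push_cast
    apply Finset.sum_congr rfl
    intro x _
    by_cases hx : ∀ i, r (f i) x
    · simp [hx]
    · rw [if_neg hx]
      push Not at hx
      obtain ⟨i, hi⟩ := hx
      symm
      apply Finset.prod_eq_zero (Finset.mem_univ i)
      simp [hi]
  have hs1 : ∑ x ∈ X, (∑ q : {q // q ∈ Q}, if r q x then (1:ℝ) else 0) ≥ Q.card * (μ * X.card) := by
    rw [Finset.sum_comm]
    have : ∀ q : {q // q ∈ Q}, μ * X.card ≤ ∑ x ∈ X, if r q x then (1:ℝ) else 0 := by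
      intro q
      have := h q q.2
      rw [Finset.card_filter] at this
      push_cast at this
      exact this
    have h2 := Finset.sum_le_sum (fun q (_ : q ∈ (Finset.univ : Finset {q // q ∈ Q})) => this q)
    simpa using h2
  rcases X.eq_empty_or_nonempty with rfl | hX
  · obtain ⟨S, hS, hc⟩ := Finset.exists_subset_card_eq hmQ
    exact ⟨S, hS, hc, by simp⟩
  have hXp : (0:ℝ) < X.card := by exact_mod_cast hX.card_pos
  have hs2 : ∑ f : F, t f ≥ X.card * (Q.card * μ) ^ m := by
    rw [ht]
    obtain ⟨m', rfl⟩ : ∃ m', m = m' + 1 := ⟨m - 1, by omega⟩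
    have := pow_sum_div_card_le_sum_pow (s := X)
      (f := fun x => (∑ q : {q // q ∈ Q}, if r q x then (1:ℝ) else 0))
      (fun x _ => Finset.sum_nonneg (fun q _ => by split_ifs <;> norm_num)) m'
    refine le_trans ?_ this
    rw [le_div_iff₀ (by positivity)]
    calc _ = (Q.card * (μ * X.card) : ℝ) ^ (m' + 1) := by ring
      _ ≤ _ := pow_le_pow_left₀ (by positivity) hs1 _
  have hs3 : ∑ f : F, t f = ∑ f ∈ I, t f + ∑ f ∈ Finset.univ.filter (fun f : F => ¬ Function.Injective f), t f :=
    (Finset.sum_filter_add_sum_filter_not _ _ _).symm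
  have hcard : (I.card : ℝ) + ((Finset.univ.filter (fun f : F => ¬ Function.Injective f)).card : ℝ) = (Q.card:ℝ) ^ m := by
    rw [← hcF]
    have := Finset.card_filter_add_card_filter_not (s := (Finset.univ : Finset F)) (fun f => Function.Injective f)
    exact_mod_cast this
  have hs4 : ∑ f ∈ Finset.univ.filter (fun f : F => ¬ Function.Injective f), t f ≤
      ((Finset.univ.filter (fun f : F => ¬ Function.Injective f)).card : ℝ) * X.card := by
    rw [← nsmul_eq_mul]
    apply Finset.sum_le_card_nsmul
    intro f _
    simp only [t]
    exact_mod_cast Finset.card_filter_le _ _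
  have hIne : I.Nonempty := by
    rw [← Finset.card_pos, hcI]
    exact Nat.descFactorial_pos.2 hmQ
  have hIle : (I.card : ℝ) ≤ (Q.card : ℝ) ^ m := by
    have : (0:ℝ) ≤ ((Finset.univ.filter (fun f : F => ¬ Function.Injective f)).card : ℝ) := by positivity
    linarith
  obtain ⟨f, hf, hle⟩ : ∃ f ∈ I, μ1 ^ m * X.card ≤ t f := by
    apply Finset.exists_le_of_sum_le hIne
    rw [Finset.sum_const, nsmul_eq_mul]
    rw [← hcI] at hM
    have hx1 : (I.card : ℝ) * (μ1 ^ m * X.card) ≤ (Q.card : ℝ) ^ m * (μ1 ^ m * X.card) :=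
      mul_le_mul_of_nonneg_right hIle (by positivity)
    have hx2 := mul_le_mul_of_nonneg_right hM hXp.le
    rw [mul_pow] at hs2
    have : ((Finset.univ.filter (fun f : F => ¬ Function.Injective f)).card : ℝ) = (Q.card:ℝ) ^ m - I.card := by linarith
    rw [this] at hs4
    nlinarith
  have hfi : Function.Injective f := (Finset.mem_filter.1 hf).2
  refine ⟨Finset.univ.image (fun i => (f i : V)), ?_, ?_, ?_⟩
  · intro x hx
    obtain ⟨i, _, rfl⟩ := Finset.mem_image.1 hx
    exact (f i).2
  · have := Finset.card_image_of_injective Finset.univ (Subtype.val_injective.comp hfi)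
    rw [Finset.card_univ, Fintype.card_fin] at this
    exact this
  · refine hle.trans_eq ?_
    simp [t]

end Book
namespace Book

set_option linter.unusedSectionVars false

variable {V : Type*} [DecidableEq V]

/-- excess of red edges -/
noncomputable def ex (c : V → V → Bool) (p : ℝ) (X Y : Finset V) : ℝ :=
  ∑ x ∈ X, (((nb c true x Y).card : ℝ) - p * Y.card)

lemma ex_le (c : V → V → Bool) {p : ℝ} (hp : 0 ≤ p) (X Y : Finset V) :
    ex c p X Y ≤ X.card * Y.card := by
  rw [ex, ← nsmul_eq_mul]
  apply Finset.sum_le_card_nsmul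
  intro x _
  have : ((nb c true x Y).card : ℝ) ≤ Y.card := by
    exact_mod_cast Finset.card_le_card (nb_subset c true x Y)
  have : 0 ≤ p * Y.card := by positivity
  linarith

lemma avg (c : V → V → Bool) (p : ℝ) (X Y : Finset V) :
    (∑ x ∈ X, ((nb c true x Y).card : ℝ)) * ex c p X Y ≤
      (∑ x ∈ X, ex c p X (nb c true x Y)) * Y.card := by
  let a : V → V → ℝ := fun x y => if y ≠ x ∧ c x y = true then 1 else 0
  have h1 : ∀ x, ((nb c true x Y).card : ℝ) = ∑ y ∈ Y, a x y := by
    intro x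
    rw [nb, Finset.card_filter]
    push_cast
    rfl
  have h2 : ∀ x x', ((nb c true x' (nb c true x Y)).card : ℝ) = ∑ y ∈ Y, a x y * a x' y := by
    intro x x'
    rw [nb, nb, Finset.filter_filter, Finset.card_filter]
    push_cast
    apply Finset.sum_congr rfl
    intro y _
    simp only [a]
    by_cases ha : y ≠ x ∧ c x y = true <;> by_cases hb : y ≠ x' ∧ c x' y = true <;> simp [ha, hb]
  let d : V → ℝ := fun y => ∑ x ∈ X, a x y
  have hD : ∑ x ∈ X, ((nb c true x Y).card : ℝ) = ∑ y ∈ Y, d y := by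
    simp_rw [h1, d]
    rw [Finset.sum_comm]
  have hex : ex c p X Y = ∑ y ∈ Y, d y - p * X.card * Y.card := by
    rw [ex, Finset.sum_sub_distrib, hD, Finset.sum_const, nsmul_eq_mul]
    ring
  have hG : ∑ x ∈ X, ex c p X (nb c true x Y) = ∑ y ∈ Y, d y ^ 2 - p * X.card * ∑ y ∈ Y, d y := by
    have e1 : ∀ x, ex c p X (nb c true x Y) =
        ∑ x' ∈ X, ∑ y ∈ Y, a x y * a x' y - p * X.card * ∑ y ∈ Y, a x y := by
      intro x
      rw [ex, Finset.sum_sub_distrib, Finset.sum_const, nsmul_eq_mul, h1]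
      simp_rw [h2]
      ring
    simp_rw [e1]
    rw [Finset.sum_sub_distrib, ← Finset.mul_sum, ← hD]
    simp_rw [h1]
    congr 1
    calc ∑ x ∈ X, ∑ x' ∈ X, ∑ y ∈ Y, a x y * a x' y
        = ∑ x ∈ X, ∑ y ∈ Y, ∑ x' ∈ X, a x y * a x' y :=
          Finset.sum_congr rfl (fun x _ => Finset.sum_comm)
      _ = ∑ y ∈ Y, ∑ x ∈ X, ∑ x' ∈ X, a x y * a x' y := Finset.sum_comm
      _ = _ := by
          apply Finset.sum_congr rfl
          intro y _
          simp only [d]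
          rw [sq, Finset.sum_mul_sum]
  have hcs : (∑ y ∈ Y, d y) ^ 2 ≤ Y.card * ∑ y ∈ Y, d y ^ 2 := sq_sum_le_card_mul_sum_sq
  rw [hD, hex, hG]
  nlinarith

lemma choose_x (c : V → V → Bool) {p δ T1 : ℝ} (hp : 0 < p) (hδ : 0 < δ) (hT1 : 0 ≤ T1)
    (X Y Bh : Finset V) (hY : Y.Nonempty) (hBX : Bh ⊆ X) (hB : (Bh.card : ℝ) ≤ T1)
    (hw : ∀ x ∈ X, p * Y.card ≤ ((nb c true x Y).card : ℝ))
    (hg : 0 < ex c p X Y / Y.card)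
    (hg1 : 2 * T1 ≤ ex c p X Y / Y.card)
    (hg2 : 2 * T1 < δ * p * (ex c p X Y / Y.card)) :
    ∃ x ∈ X, x ∉ Bh ∧ (1 - δ) * (ex c p X Y / Y.card) * (nb c true x Y).card ≤
      ex c p X (nb c true x Y) := by
  have hYp : (0:ℝ) < Y.card := by exact_mod_cast hY.card_pos
  set g := ex c p X Y / Y.card with hgdef
  have hgX : g ≤ X.card := by
    rw [hgdef, div_le_iff₀ hYp]; exact ex_le c hp.le X Y
  by_contra hcon
  push Not at hcon
  have hav := avg c p X Y
  have hexg : ex c p X Y = g * Y.card := by rw [hgdef]; field_simp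
  rw [hexg] at hav
  have hav' : ∑ x ∈ X, g * ((nb c true x Y).card : ℝ) ≤ ∑ x ∈ X, ex c p X (nb c true x Y) := by
    rw [← Finset.mul_sum]
    have := hav
    nlinarith
  rw [← Finset.sum_sdiff hBX, ← Finset.sum_sdiff hBX] at hav'
  have h1 : ∑ x ∈ X \ Bh, ex c p X (nb c true x Y) ≤
      ∑ x ∈ X \ Bh, (g * ((nb c true x Y).card : ℝ) - δ * g * (p * Y.card)) := by
    apply Finset.sum_le_sum
    intro x hx
    rw [Finset.mem_sdiff] at hx
    have := hcon x hx.1 hx.2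
    have h3 := mul_le_mul_of_nonneg_left (hw x hx.1) (mul_pos hδ hg).le
    linarith
  have h2 : ∑ x ∈ Bh, ex c p X (nb c true x Y) ≤ T1 * (X.card * Y.card) := by
    calc ∑ x ∈ Bh, ex c p X (nb c true x Y) ≤ Bh.card • ((X.card : ℝ) * Y.card) := by
          apply Finset.sum_le_card_nsmul
          intro x _
          refine (ex_le c hp.le _ _).trans ?_
          exact mul_le_mul_of_nonneg_left
            (Nat.cast_le.2 (Finset.card_le_card (nb_subset _ _ _ _))) (Nat.cast_nonneg _)
      _ ≤ _ := by
          rw [nsmul_eq_mul]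
          exact mul_le_mul_of_nonneg_right hB (mul_nonneg (Nat.cast_nonneg _) (Nat.cast_nonneg _))
  have h3 : 0 ≤ ∑ x ∈ Bh, g * ((nb c true x Y).card : ℝ) :=
    Finset.sum_nonneg (fun x _ => mul_nonneg hg.le (Nat.cast_nonneg _))
  rw [Finset.sum_sub_distrib, Finset.sum_const, nsmul_eq_mul] at h1
  have h4 : ((X \ Bh).card : ℝ) = X.card - Bh.card := by
    rw [Finset.card_sdiff_of_subset hBX, Nat.cast_sub (Finset.card_le_card hBX)]
  rw [h4] at h1
  have h5 : ((X.card : ℝ) - Bh.card) * (δ * g * (p * Y.card)) ≤ T1 * (X.card * Y.card) := by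
    linarith
  have h6 : (X.card : ℝ) / 2 ≤ X.card - Bh.card := by linarith
  have h7 : (X.card : ℝ) / 2 * (δ * g * (p * Y.card)) ≤ T1 * (X.card * Y.card) :=
    (mul_le_mul_of_nonneg_right h6
      (mul_nonneg (mul_pos hδ hg).le (mul_pos hp hYp).le)).trans h5
  have hXp : (0:ℝ) < X.card := lt_of_lt_of_le hg hgX
  have h8 : T1 * (X.card * Y.card) < (X.card : ℝ) / 2 * (δ * g * (p * Y.card)) := by
    have := mul_lt_mul_of_pos_right hg2 (mul_pos hXp hYp)
    nlinarith
  linarith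

end Book
namespace Book

set_option linter.unusedSectionVars false

variable {V : Type*} [DecidableEq V]

lemma step_bound (n : ℕ) {g g' y y' p a ν s s' β x x' D : ℝ} (hg : 0 < g) (ha : 0 < a) (hν : 0 < ν)
    (hs' : 0 ≤ s') (hp : 0 < p) (hy : 0 ≤ y) (hyy : p * y ≤ y') (hD : 0 ≤ D)
    (hs : s = (p * a ^ (n + 3) * ν ^ 3) * s') (hβ : 0 < β) (hx0 : 0 ≤ x') (hx : x' ≤ β * x)
    (hIH : g' ^ (n + 3) * y' * s' ≤ D * x' ^ n)
    (hP : D * x ^ n < g ^ (n + 3) * y * s) :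
    g' ≤ g * a * ((n * β + 3 * ν) / (n + 3)) := by
  by_contra hcon
  push Not at hcon
  have hZ : 0 < (n * β + 3 * ν) / (n + 3) := by positivity
  have h1 := amgm n hβ.le hν.le
  have h2 : (g * a * ((n * β + 3 * ν) / (n + 3))) ^ (n + 3) ≤ g' ^ (n + 3) :=
    pow_le_pow_left₀ (by positivity) hcon.le _
  have h3 : g ^ (n + 3) * a ^ (n + 3) * (β ^ n * ν ^ 3) ≤ g' ^ (n + 3) := by
    refine le_trans ?_ h2
    rw [mul_pow, mul_pow]
    exact mul_le_mul_of_nonneg_left h1 (by positivity)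
  have h4 : g ^ (n + 3) * a ^ (n + 3) * (β ^ n * ν ^ 3) * (p * y) * s' ≤ g' ^ (n + 3) * y' * s' := by
    have h0 : 0 ≤ g ^ (n + 3) * a ^ (n + 3) * (β ^ n * ν ^ 3) := by positivity
    exact mul_le_mul_of_nonneg_right
      (mul_le_mul h3 hyy (by positivity) (h0.trans h3)) hs'
  have h5 : D * x' ^ n ≤ D * (β * x) ^ n :=
    mul_le_mul_of_nonneg_left (pow_le_pow_left₀ hx0 hx n) hD
  have h6 : β ^ n * (D * x ^ n) < β ^ n * (g ^ (n + 3) * y * s) :=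
    mul_lt_mul_of_pos_left hP (by positivity)
  rw [hs] at h6
  rw [mul_pow] at h5
  have e : g ^ (n + 3) * a ^ (n + 3) * (β ^ n * ν ^ 3) * (p * y) * s' =
    β ^ n * (g ^ (n + 3) * y * (p * a ^ (n + 3) * ν ^ 3 * s')) := by ring
  linarith

lemma real_base (n : ℕ) {g x y r s T E : ℝ} (hg : 0 < g) (hgx : g ≤ x) (hy : 0 ≤ y) (hr : 0 ≤ r)
    (hs0 : 0 ≤ s) (hs : s ≤ 1) (hgT : g ≤ T) (h1 : y * r ≤ E) :
    g ^ (n + 3) * y * (r * s) ≤ T ^ 3 * E * x ^ n := by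
  have h2 : g ^ n ≤ x ^ n := pow_le_pow_left₀ hg.le hgx n
  have h3 : g ^ 3 ≤ T ^ 3 := pow_le_pow_left₀ hg.le hgT 3
  have hT : 0 ≤ T := hg.le.trans hgT
  have hE : 0 ≤ E := (mul_nonneg hy hr).trans h1
  calc g ^ (n + 3) * y * (r * s) = (g ^ 3 * (y * r) * g ^ n) * s := by ring
    _ ≤ (g ^ 3 * (y * r) * g ^ n) * 1 := by
        apply mul_le_mul_of_nonneg_left hs
        positivity
    _ = g ^ 3 * (y * r) * g ^ n := mul_one _
    _ ≤ T ^ 3 * E * x ^ n := by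
        apply mul_le_mul (mul_le_mul h3 h1 (by positivity) (by positivity)) h2 (by positivity)
        positivity

lemma real_removal (n : ℕ) (hn : 3 ≤ n) {g g' x y s D : ℝ} (hg : 0 < g) (hx : 1 < x) (hy : 0 ≤ y)
    (hs : 0 ≤ s) (hbig : g * (1 - (1 / x) / 2) ≤ g')
    (hI : g' ^ (n + 3) * y * s ≤ D * (x - 1) ^ n)
    (hP : D * x ^ n < g ^ (n + 3) * y * s) : False := by
  have hx0 : 0 < x := by linarith
  have hix : 1 / x < 1 := by rw [div_lt_one hx0]; exact hx
  have hr := removal n hn (x := 1 / x) (by positivity) hix.le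
  have hpos : 0 < g * (1 - (1 / x) / 2) := mul_pos hg (by linarith)
  have h1 := pow_le_pow_left₀ hpos.le hbig (n + 3)
  rw [mul_pow] at h1
  have h2 : g ^ (n + 3) * (1 - 1 / x) ^ n ≤ g' ^ (n + 3) :=
    (mul_le_mul_of_nonneg_left hr (by positivity)).trans h1
  have hxx : x - 1 = (1 - 1 / x) * x := by field_simp
  have hθ : 0 < 1 - 1 / x := by linarith
  rw [hxx, mul_pow] at hI
  have h3 := mul_le_mul_of_nonneg_right h2 (mul_nonneg hy hs)
  have h4 := mul_lt_mul_of_pos_right hP (pow_pos hθ n)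
  have e1 : g ^ (n + 3) * (1 - 1 / x) ^ n * (y * s) = g ^ (n + 3) * y * s * (1 - 1 / x) ^ n := by ring
  have e2 : D * ((1 - 1 / x) ^ n * x ^ n) = D * x ^ n * (1 - 1 / x) ^ n := by ring
  rw [e2] at hI
  rw [e1] at h3
  have e3 : g' ^ (n + 3) * (y * s) = g' ^ (n + 3) * y * s := by ring
  rw [e3] at h3
  linarith

lemma real_big (n : ℕ) {g g' x y z r s sm w D : ℝ} (hg : 0 < g) (hx : 0 < x) (hy : 0 ≤ y)
    (hz : 0 < z) (hr : 0 ≤ r) (hs : 0 ≤ s) (hw : 0 ≤ w)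
    (hzx : w * x ≤ z) (hsm : sm * 2 ^ (n + 3) ≤ w ^ 3)
    (hZg : z * (g / x / 2) ≤ g')
    (hI : g' ^ (n + 3) * y * (r * s) ≤ D * z ^ n) :
    g ^ (n + 3) * y * (r * (s * sm)) ≤ D * x ^ n := by
  have h1 := pow_le_pow_left₀ (by positivity) hZg (n + 3)
  have hs0 : 0 ≤ y * (r * s) := by positivity
  have h2 : (z * (g / x / 2)) ^ (n + 3) * (y * (r * s)) ≤ D * z ^ n := by
    refine (mul_le_mul_of_nonneg_right h1 hs0).trans ?_
    rw [← mul_assoc]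
    exact hI
  have h3 : z ^ 3 * (g / x / 2) ^ (n + 3) * (y * (r * s)) ≤ D := by
    have e : (z * (g / x / 2)) ^ (n + 3) * (y * (r * s))
      = (z ^ 3 * (g / x / 2) ^ (n + 3) * (y * (r * s))) * z ^ n := by
      rw [mul_pow, pow_add z]; ring
    rw [e] at h2
    exact le_of_mul_le_mul_right h2 (by positivity)
  have h4 : (w * x) ^ 3 ≤ z ^ 3 := pow_le_pow_left₀ (by positivity) hzx 3
  have h5 : (sm * 2 ^ (n + 3)) * x ^ 3 ≤ z ^ 3 := by
    refine le_trans ?_ h4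
    rw [mul_pow]
    exact mul_le_mul_of_nonneg_right hsm (by positivity)
  have h6 : (sm * 2 ^ (n + 3)) * x ^ 3 * (g / x / 2) ^ (n + 3) * (y * (r * s)) ≤ D := by
    refine le_trans ?_ h3
    apply mul_le_mul_of_nonneg_right _ hs0
    exact mul_le_mul_of_nonneg_right h5 (by positivity)
  have e2 : ((sm * 2 ^ (n + 3)) * x ^ 3 * (g / x / 2) ^ (n + 3) * (y * (r * s))) * x ^ n
      = g ^ (n + 3) * y * (r * (s * sm)) := by
    rw [div_pow, div_pow, pow_add x]
    field_simp
  have h7 := mul_le_mul_of_nonneg_right h6 (pow_nonneg hx.le n)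
  rw [e2] at h7
  exact h7

lemma real_nonneg (n : ℕ) {g a b v : ℝ} (hg : 0 < g) (ha : 0 < a) (hb : 0 ≤ b) (hv : 0 < v) :
    0 ≤ g * a * ((n * b + 3 * v) / (n + 3)) := by positivity

lemma real_final (n : ℕ) {g A B β μ δ T r b : ℝ} (hg : 0 < g) (hAB : A ≤ B) (hβ1 : β < μ)
    (hδ : 0 < δ) (hsum : A * (1 - μ) + B * μ ≤ 1 - 2 * δ) (hgT : T < g) (hTc : 1 ≤ δ * T)
    (hsum2 : (1 - δ) * g - 1 ≤ r + b)
    (hR : r ≤ g * A * ((n * (1 - β) + 3 * (1 - μ)) / (n + 3)))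
    (hB : b ≤ g * B * ((n * β + 3 * μ) / (n + 3))) : False := by
  have hn3 : (0:ℝ) < n + 3 := by positivity
  have hfin : A * ((n * (1 - β) + 3 * (1 - μ)) / (n + 3)) + B * ((n * β + 3 * μ) / (n + 3)) ≤ 1 - 2 * δ := by
    refine le_trans ?_ hsum
    rw [mul_div_assoc', mul_div_assoc', ← add_div, div_le_iff₀ hn3]
    have : 0 ≤ (n : ℝ) * ((B - A) * (μ - β)) :=
      mul_nonneg (Nat.cast_nonneg _) (mul_nonneg (by linarith) (by linarith))
    nlinarith
  have hfin2 := mul_le_mul_of_nonneg_left hfin hg.le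
  have h9 : δ * T < δ * g := mul_lt_mul_of_pos_left hgT hδ
  rw [mul_add, ← mul_assoc, ← mul_assoc] at hfin2
  linarith

set_option maxHeartbeats 1000000 in
theorem book {c : V → V → Bool} (hc : ∀ v w, c v w = c w v)
    {p A B μ μ1 δ T1 T E ρ σ : ℝ} {n m M K : ℕ} (hn : 3 ≤ n) (hp : 0 < p)
    (hA : 0 < A) (hAB : A ≤ B) (hμ : 0 < μ) (hμ' : μ < 1) (hμ1 : 0 < μ1) (hδ : 0 < δ)
    (hsum : A * (1 - μ) + B * μ ≤ 1 - 2 * δ)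
    (hρ : ρ = p * A ^ (n + 3) * (1 - μ) ^ 3) (hσ : σ = p * B ^ (n + 3) * μ ^ 3)
    (hσ1 : σ ≤ 1) (hm : 1 ≤ m) (hmM : m ≤ M)
    (hM : μ1 ^ m * (M : ℝ) ^ m ≤ μ ^ m * (M : ℝ) ^ m - (M : ℝ) ^ m + (M.descFactorial m : ℝ))
    (hσm : σ ^ m * 2 ^ (n + 3) ≤ (μ1 ^ m) ^ 3)
    (hT1 : ∀ S : Finset V, Free c true K S → Free c false M S → (S.card : ℝ) ≤ T1)
    (hTa : 2 * T1 ≤ δ * p * T) (hTb : 2 * T1 ≤ T) (hTc : 1 ≤ δ * T) (hE : 0 ≤ E) :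
    ∀ (N : ℕ) (X Y : Finset V) (k l : ℕ), X.card = N → k ≤ K → Free c true k (X ∪ Y) →
      Free c false l X → (∀ S ⊆ Y, ∀ j, Free c true j S → (S.card : ℝ) * ρ ^ j ≤ E) →
      0 < ex c p X Y →
      (ex c p X Y / Y.card) ^ (n + 3) * Y.card * (ρ ^ k * σ ^ l) ≤ T ^ 3 * E * (X.card : ℝ) ^ n := by
  intro N
  induction N using Nat.strong_induction_on with
  | _ N ih =>
  intro X Y k l hN hkK hk hl hY hex
  have hTpos : 0 < T := by
    by_contra h
    push Not at h
    nlinarith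
  have h1μ : 0 < 1 - μ := by linarith
  have hB : 0 < B := hA.trans_le hAB
  have hρ0 : 0 < ρ := by rw [hρ]; positivity
  have hσ0 : 0 < σ := by rw [hσ]; positivity
  have hYne : Y.Nonempty := by
    rw [Finset.nonempty_iff_ne_empty]
    rintro rfl
    simp [ex, nb] at hex
  have hXne : X.Nonempty := by
    rw [Finset.nonempty_iff_ne_empty]
    rintro rfl
    simp [ex] at hex
  have hYp : (0:ℝ) < Y.card := by exact_mod_cast hYne.card_pos
  have hXp : (0:ℝ) < X.card := by exact_mod_cast hXne.card_pos
  set g := ex c p X Y / Y.card with hgdef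
  have hg : 0 < g := div_pos hex hYp
  have hgX : g ≤ X.card := by
    rw [hgdef, div_le_iff₀ hYp]; exact ex_le c hp.le X Y
  -- base case
  rcases le_or_gt g T with hgT | hgT
  · have h1 := hY Y subset_rfl k (hk.mono Finset.subset_union_right)
    exact real_base n hg hgX hYp.le (pow_pos hρ0 k).le (pow_pos hσ0 l).le (pow_le_one₀ hσ0.le hσ1) hgT h1
  by_contra hP
  push Not at hP
  have hD0 : 0 ≤ T ^ 3 * E := mul_nonneg (pow_pos hTpos 3).le hE
  have hexg : ∑ x ∈ X, (((nb c true x Y).card : ℝ) / Y.card - p) = g := by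
    rw [hgdef, ex, Finset.sum_div]
    apply Finset.sum_congr rfl
    intro x _
    field_simp
  have hexg' : ∀ X' : Finset V, ex c p X' Y / Y.card = ∑ x ∈ X', (((nb c true x Y).card : ℝ) / Y.card - p) := by
    intro X'
    rw [ex, Finset.sum_div]
    apply Finset.sum_congr rfl
    intro x _
    field_simp
  have hT1g : 2 * T1 < g := by linarith
  -- all weights are large
  have hw : ∀ x ∈ X, g / X.card / 2 ≤ ((nb c true x Y).card : ℝ) / Y.card - p := by
    intro x hx
    by_contra hcon
    push Not at hcon
    have hs := Finset.sum_erase_add X (fun x => ((nb c true x Y).card : ℝ) / Y.card - p) hx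
    rw [hexg, ← hexg' (X.erase x)] at hs
    have hc1 : ((X.erase x).card : ℝ) = X.card - 1 := by
      rw [Finset.card_erase_of_mem hx, Nat.cast_sub hXne.card_pos]; simp
    have hX1 : (1:ℝ) ≤ X.card := by exact_mod_cast hXne.card_pos
    have hbig : g * (1 - (1 / X.card) / 2) ≤ ex c p (X.erase x) Y / Y.card := by
      have : g / X.card / 2 = g * ((1 / X.card) / 2) := by ring
      rw [this] at hcon
      linarith
    have hix : 1 / (X.card : ℝ) ≤ 1 := by rw [div_le_one hXp]; exact hX1
    have hpos : 0 < g * (1 - (1 / X.card) / 2) := by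
      apply mul_pos hg; linarith
    have hexp : 0 < ex c p (X.erase x) Y := by
      have := hpos.trans_le hbig
      exact (div_pos_iff_of_pos_right hYp).1 this
    have hI := ih _ (by rw [← hN]; exact Finset.card_erase_lt_of_mem hx) (X.erase x) Y k l rfl hkK
      (hk.mono (Finset.union_subset_union_left (Finset.erase_subset _ _)))
      (hl.mono (Finset.erase_subset _ _)) hY hexp
    rw [hc1] at hI
    rcases eq_or_lt_of_le hX1 with h11 | h11
    · -- X is a singleton
      have he : X.erase x = ∅ := by
        rw [← Finset.card_eq_zero, Finset.card_erase_of_mem hx]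
        have : X.card = 1 := by exact_mod_cast h11.symm
        omega
      rw [he] at hexp
      simp [ex] at hexp
    · exact real_removal n hn hg h11 hYp.le (mul_pos (pow_pos hρ0 k) (pow_pos hσ0 l)).le hbig hI hP
  have hε : 0 < g / X.card := div_pos hg hXp
  have hdeg : ∀ x ∈ X, p * Y.card ≤ ((nb c true x Y).card : ℝ) := by
    intro x hx
    have := hw x hx
    rw [← le_div_iff₀ hYp]
    linarith
  let Bh : Finset V := X.filter (fun x => μ * X.card ≤ ((nb c false x X).card : ℝ))
  have hBhX : Bh ⊆ X := Finset.filter_subset _ _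
  have hkX : Free c true k X := hk.mono Finset.subset_union_left
  rcases lt_or_ge T1 (Bh.card : ℝ) with hBh | hBh
  · -- big blue step
    have hnf : ¬ Free c false M Bh := by
      intro hf
      have hfK : Free c true K Bh := fun T' hT' hcl => (hkX T' (hT'.trans hBhX) hcl).trans_le hkK
      exact absurd (hT1 Bh hfK hf) (not_le.2 hBh)
    unfold Free at hnf
    push Not at hnf
    obtain ⟨Q', hQ'B, hQ'c, hQ'M⟩ := hnf
    obtain ⟨Q, hQQ', hQM⟩ := Finset.exists_subset_card_eq hQ'M
    obtain ⟨S, hSQ, hSm, hSX⟩ := blue_book hμ.le hμ1.le (fun q x => x ≠ q ∧ c q x = false) Q X m hm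
      (by rw [hQM]; exact hmM) (by rw [hQM]; exact hM) (by
        intro q hq
        have := (Finset.mem_filter.1 (hQ'B (hQQ' hq))).2
        exact this)
    set Z := X.filter (fun x => ∀ s ∈ S, x ≠ s ∧ c s x = false) with hZ
    have hSX' : S ⊆ X := hSQ.trans (hQQ'.trans (hQ'B.trans hBhX))
    have hScl : Clq c false S := fun v hv w hw' => hQ'c v (hQQ' (hSQ hv)) w (hQQ' (hSQ hw'))
    have hZX : Z ⊆ X := Finset.filter_subset _ _
    have hdis : Disjoint S Z := by
      rw [Finset.disjoint_left]
      intro s hs hsZ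
      exact ((Finset.mem_filter.1 hsZ).2 s hs).1 rfl
    have hml : m < l := by
      have := hl S hSX' hScl
      omega
    have hZp : (0:ℝ) < Z.card := lt_of_lt_of_le (mul_pos (pow_pos hμ1 m) hXp) hSX
    have hZlt : Z.card < N := by
      rw [← hN]
      apply Finset.card_lt_card
      refine Finset.ssubset_iff_subset_ne.2 ⟨hZX, ?_⟩
      intro he
      have hSe : S = ∅ := by
        rw [he] at hdis
        exact Finset.disjoint_self_iff_empty S |>.1 (hdis.mono_right hSX')
      rw [hSe] at hSm
      simp at hSm
      omega
    have hZg : (Z.card : ℝ) * (g / X.card / 2) ≤ ex c p Z Y / Y.card := by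
      rw [hexg' Z, ← nsmul_eq_mul]
      exact Finset.card_nsmul_le_sum _ _ _ (fun x hx => hw x (hZX hx))
    have hZex : 0 < ex c p Z Y := by
      refine (div_pos_iff_of_pos_right hYp).1 (lt_of_lt_of_le ?_ hZg)
      exact mul_pos hZp (half_pos hε)
    have hI := ih _ hZlt Z Y k (l - m) rfl hkK
      (hk.mono (Finset.union_subset_union_left hZX)) (by
        intro T' hT' hcl
        have hd' : Disjoint S T' := hdis.mono_right hT'
        have := hl (S ∪ T') (Finset.union_subset hSX' (hT'.trans hZX)) (by
          intro v hv w hw' hvw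
          rcases Finset.mem_union.1 hv with hv | hv <;> rcases Finset.mem_union.1 hw' with hw' | hw'
          · exact hScl v hv w hw' hvw
          · exact ((Finset.mem_filter.1 (hT' hw')).2 v hv).2
          · rw [hc]; exact ((Finset.mem_filter.1 (hT' hv)).2 w hw').2
          · exact hcl v hv w hw' hvw)
        rw [Finset.card_union_of_disjoint hd'] at this
        omega) hY hZex
    have hl' : σ ^ l = σ ^ (l - m) * σ ^ m := by rw [← pow_add]; congr 1; omega
    rw [hl'] at hP
    exact absurd (real_big n hg hXp hYp.le hZp (pow_pos hρ0 k).le (pow_pos hσ0 _).le (pow_pos hμ1 m).le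
      hSX hσm hZg hI) (not_le.2 hP)
  · -- main step
    have hT10 : 0 ≤ T1 := le_trans (Nat.cast_nonneg _) hBh
    obtain ⟨x, hx, hxB, hxg⟩ := choose_x c hp hδ hT10 X Y Bh hYne hBhX hBh hdeg hg hT1g.le (by
      refine lt_of_le_of_lt hTa ?_
      exact mul_lt_mul_of_pos_left hgT (mul_pos hδ hp))
    rw [← hgdef] at hxg
    set Y' := nb c true x Y with hY'
    set XR := nb c true x X with hXR
    set XB := nb c false x X with hXB
    have hXRX : XR ⊆ X := nb_subset _ _ _ _
    have hXBX : XB ⊆ X := nb_subset _ _ _ _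
    have hY'Y : Y' ⊆ Y := nb_subset _ _ _ _
    have hyy : p * Y.card ≤ (Y'.card : ℝ) := hdeg x hx
    have hY'p : (0:ℝ) < Y'.card := lt_of_lt_of_le (mul_pos hp hYp) hyy
    have hcard : (XR.card : ℝ) + XB.card + 1 = X.card := by exact_mod_cast card_split c x X hx
    have hβμ : (XB.card : ℝ) < μ * X.card := by
      by_contra h
      push Not at h
      exact hxB (Finset.mem_filter.2 ⟨hx, h⟩)
    have hcN : XR.card + XB.card + 1 = N := by rw [← hN]; exact card_split c x X hx
    have hsplit : ex c p X Y' = ex c p XR Y' + ex c p XB Y' + (((nb c true x Y').card : ℝ) - p * Y'.card) :=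
      sum_split c x X hx _
    have hself : ((nb c true x Y').card : ℝ) - p * Y'.card ≤ Y'.card := by
      have h1 : ((nb c true x Y').card : ℝ) ≤ Y'.card := by
        exact_mod_cast Finset.card_le_card (nb_subset _ _ _ _)
      have h2 := mul_pos hp hY'p
      linarith
    have hsum2 : (1 - δ) * g - 1 ≤ ex c p XR Y' / Y'.card + ex c p XB Y' / Y'.card := by
      rw [← add_div, le_div_iff₀ hY'p]
      linarith
    have hY2 : ∀ S ⊆ Y', ∀ j, Free c true j S → (S.card : ℝ) * ρ ^ j ≤ E :=
      fun S hS => hY S (hS.trans hY'Y)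
    set β : ℝ := XB.card / X.card with hβ
    have hβ0 : 0 ≤ β := div_nonneg (Nat.cast_nonneg _) hXp.le
    have hβ1 : β < μ := by rw [hβ, div_lt_iff₀ hXp]; exact hβμ
    have hβX : (XB.card : ℝ) = β * X.card := (div_mul_cancel₀ _ hXp.ne').symm
    have hkp := hk.pos
    have hlp := hl.pos
    have hR : ex c p XR Y' / Y'.card ≤ g * A * ((n * (1 - β) + 3 * (1 - μ)) / (n + 3)) := by
      have h1β : 0 < 1 - β := by linarith
      rcases le_or_gt (ex c p XR Y') 0 with hle | hgt
      · refine (div_nonpos_of_nonpos_of_nonneg hle hY'p.le).trans ?_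
        exact real_nonneg n hg hA h1β.le h1μ
      · have hI := ih _ (by omega) XR Y' (k - 1) l rfl (by omega)
          (hk.step hc (Finset.mem_union_left _ hx) (Finset.union_subset_union hXRX hY'Y) (by
            intro w hw'
            rcases Finset.mem_union.1 hw' with hw' | hw'
            · exact (mem_nb.1 hw').2
            · exact (mem_nb.1 hw').2)) (hl.mono hXRX) hY2 hgt
        refine step_bound n (s := ρ ^ k * σ ^ l) (s' := ρ ^ (k - 1) * σ ^ l) hg hA h1μ (mul_pos (pow_pos hρ0 _) (pow_pos hσ0 _)).le hp
          hYp.le hyy hD0 ?_ h1β (Nat.cast_nonneg _) ?_ hI hP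
        · rw [← hρ, ← mul_assoc, ← pow_succ']
          congr 2
          omega
        · linarith
    have hBb : ex c p XB Y' / Y'.card ≤ g * B * ((n * β + 3 * μ) / (n + 3)) := by
      rcases le_or_gt (ex c p XB Y') 0 with hle | hgt
      · refine (div_nonpos_of_nonpos_of_nonneg hle hY'p.le).trans ?_
        exact real_nonneg n hg hB hβ0 hμ
      · have hI := ih _ (by omega) XB Y' k (l - 1) rfl hkK
          (hk.mono (Finset.union_subset_union hXBX hY'Y))
          (hl.step hc hx hXBX (fun w hw' => (mem_nb.1 hw').2)) hY2 hgt
        have hXBne : XB.Nonempty := by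
          rw [Finset.nonempty_iff_ne_empty]
          intro he
          rw [he] at hgt
          simp [ex] at hgt
        have hβp : 0 < β := div_pos (by exact_mod_cast hXBne.card_pos) hXp
        refine step_bound n (s := ρ ^ k * σ ^ l) (s' := ρ ^ k * σ ^ (l - 1)) hg hB hμ (mul_pos (pow_pos hρ0 _) (pow_pos hσ0 _)).le hp
          hYp.le hyy hD0 ?_ hβp (Nat.cast_nonneg _) hβX.le hI hP
        rw [← hσ, mul_left_comm, ← pow_succ']
        congr 2
        omega
    exact real_final n hg hAB hβ1 hδ hsum hgT hTc hsum2 hR hBb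

end Book
namespace Book

set_option linter.unusedSectionVars false

set_option exponentiation.threshold 1000 in
lemma num_bound : (1:ℝ) ≤ (408 / 100000) ^ 50 * 2 ^ 397 := by norm_num

lemma exists_m {σ μ1 : ℝ} (hμ1 : 0 < μ1) (hσ : 0 ≤ σ) (h : σ < μ1 ^ 3) (n : ℕ) :
    ∃ m : ℕ, 1 ≤ m ∧ σ ^ m * 2 ^ (n + 3) ≤ (μ1 ^ m) ^ 3 := by
  have h3 : 0 < μ1 ^ 3 := by positivity
  have h1 : σ / μ1 ^ 3 < 1 := (div_lt_one h3).2 h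
  obtain ⟨m, hm⟩ := exists_pow_lt_of_lt_one (show (0:ℝ) < 1 / 2 ^ (n + 3) by positivity) h1
  refine ⟨m, ?_, ?_⟩
  · by_contra hcon
    have : m = 0 := by omega
    rw [this, pow_zero, lt_div_iff₀ (by positivity)] at hm
    have : (1:ℝ) ≤ 2 ^ (n + 3) := one_le_pow₀ (by norm_num)
    linarith
  · rw [div_pow, div_lt_div_iff₀ (by positivity) (by positivity), one_mul] at hm
    have e : (μ1 ^ m) ^ 3 = (μ1 ^ 3) ^ m := by rw [← pow_mul, ← pow_mul, mul_comm]
    rw [e]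
    exact hm.le

lemma exists_M {μ μ1 : ℝ} (hμ1 : 0 < μ1) (h : μ1 < μ) (m : ℕ) (hm : 1 ≤ m) :
    ∃ M : ℕ, m ≤ M ∧
      μ1 ^ m * (M : ℝ) ^ m ≤ μ ^ m * (M : ℝ) ^ m - (M : ℝ) ^ m + (M.descFactorial m : ℝ) := by
  have hd : 0 < μ ^ m - μ1 ^ m := sub_pos.2 (pow_lt_pow_left₀ h hμ1.le (by omega))
  set d := μ ^ m - μ1 ^ m with hdd
  obtain ⟨M0, hM0⟩ := exists_nat_ge ((m : ℝ) ^ 2 / d)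
  refine ⟨max m M0, le_max_left _ _, ?_⟩
  set M := max m M0
  have hmM : m ≤ M := le_max_left _ _
  have hMr : (m : ℝ) ^ 2 / d ≤ M := hM0.trans (by exact_mod_cast le_max_right _ _)
  have hMp : (0:ℝ) < M := by exact_mod_cast (by omega : 0 < M)
  rw [div_le_iff₀ hd] at hMr
  have h1 : ((M : ℝ) - m) ^ m ≤ M.descFactorial m := by
    have h2 : (((M + 1 - m : ℕ) : ℝ)) ^ m ≤ M.descFactorial m := by
      exact_mod_cast Nat.pow_sub_le_descFactorial M m
    refine le_trans ?_ h2
    apply pow_le_pow_left₀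
    · have : (m : ℝ) ≤ M := by exact_mod_cast hmM
      linarith
    · rw [Nat.cast_sub (by omega)]
      push_cast
      linarith
  have h3 : (M : ℝ) ^ m * (1 - d) ≤ ((M : ℝ) - m) ^ m := by
    have e : (M : ℝ) - m = M * (1 + -(m / M)) := by field_simp; ring
    rw [e, mul_pow]
    apply mul_le_mul_of_nonneg_left _ (by positivity)
    have hb := one_add_mul_le_pow (a := -((m : ℝ) / M)) (by
      have : (m : ℝ) / M ≤ 1 := by
        rw [div_le_one hMp]; exact_mod_cast hmM
      linarith) m
    refine le_trans ?_ hb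
    have : (m : ℝ) * (m / M) ≤ d := by
      rw [mul_div_assoc', div_le_iff₀ hMp]
      linarith
    linarith
  have h4 : μ1 ^ m = μ ^ m - d := by rw [hdd]; ring
  rw [h4]
  nlinarith

set_option maxHeartbeats 2000000 in
lemma half_case : ∃ C : ℝ, 0 < C ∧ ∀ (N k : ℕ) (c : Fin N → Fin N → Bool),
    (∀ v w, c v w = c w v) → Free c true k Finset.univ → Free c false k Finset.univ →
    ((N : ℝ) * (N - 1) / 2 ≤ ∑ x : Fin N, ((nb c true x Finset.univ).card : ℝ)) →
    100000 ≤ N → (N : ℝ) ^ 4 * (408 / 100000 : ℝ) ^ k ≤ C := by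
  obtain ⟨p, hp⟩ : ∃ p : ℝ, p = 49999 / 100000 := ⟨_, rfl⟩
  obtain ⟨A, hA⟩ : ∃ p : ℝ, p = 991233 / 1000000 := ⟨_, rfl⟩
  obtain ⟨B, hB⟩ : ∃ p : ℝ, p = 1011619 / 1000000 := ⟨_, rfl⟩
  obtain ⟨μ, hμ⟩ : ∃ p : ℝ, p = 43 / 100 := ⟨_, rfl⟩
  obtain ⟨μ1, hμ1⟩ : ∃ p : ℝ, p = 429995 / 1000000 := ⟨_, rfl⟩
  obtain ⟨u, hu⟩ : ∃ p : ℝ, p = 999 / 1000 := ⟨_, rfl⟩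
  obtain ⟨δ, hδ⟩ : ∃ p : ℝ, p = 1 / 2000000 := ⟨_, rfl⟩
  obtain ⟨ρ, hρ⟩ : ∃ ρ : ℝ, ρ = p * A ^ (57 + 3) * (1 - μ) ^ 3 := ⟨_, rfl⟩
  obtain ⟨σ, hσ⟩ : ∃ σ : ℝ, σ = p * B ^ (57 + 3) * μ ^ 3 := ⟨_, rfl⟩
  have hσμ : σ < μ1 ^ 3 := by rw [hσ, hμ1, hp, hB, hμ]; norm_num
  have hθ : 408 / 100000 ≤ u ^ 3 * (ρ * σ * (1 - ρ)) := by
    rw [hρ, hσ, hu, hp, hA, hB, hμ]; norm_num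
  have hρ1 : ρ < 1 := by rw [hρ, hp, hA, hμ]; norm_num
  have hρ0 : 0 < ρ := by rw [hρ, hp, hA, hμ]; norm_num
  have hσ0 : 0 < σ := by rw [hσ, hp, hB, hμ]; norm_num
  have hσ1 : σ ≤ 1 := hσμ.le.trans (by rw [hμ1]; norm_num)
  have hμ10 : 0 < μ1 := by rw [hμ1]; norm_num
  obtain ⟨m, hm, hσm⟩ := exists_m hμ10 hσ0.le hσμ 57
  obtain ⟨M, hmM, hM⟩ := exists_M hμ10 (show μ1 < μ by rw [hμ1, hμ]; norm_num) m hm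
  have hu0 : 0 < u := by rw [hu]; norm_num
  have hu1 : 0 < 1 - u := by rw [hu]; norm_num
  have hρ1' : 0 < 1 - ρ := by linarith
  obtain ⟨C1, hC1⟩ : ∃ C1 : ℝ, C1 = 10 ^ 8 := ⟨_, rfl⟩
  obtain ⟨ξ, hξ⟩ : ∃ ξ : ℝ, ξ = 1 / 200000 := ⟨_, rfl⟩
  have hξ0 : 0 < ξ := by rw [hξ]; norm_num
  have hC10 : 0 < C1 := by rw [hC1]; norm_num
  refine ⟨C1 ^ 3 / ((1 - u) ^ M) ^ 3 / ξ ^ 60, by positivity, ?_⟩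
  intro N k c hc hk hl hdeg hN
  have hNr : (100000 : ℝ) ≤ N := by exact_mod_cast hN
  have hNp : (0 : ℝ) < N := by linarith
  obtain ⟨T1, hT1⟩ : ∃ T1 : ℝ, T1 = 1 / (u ^ k * (1 - u) ^ M) := ⟨_, rfl⟩
  obtain ⟨E, hE⟩ : ∃ E : ℝ, E = 1 / (1 - ρ) ^ k := ⟨_, rfl⟩
  have hq0 : 0 < u ^ k * (1 - u) ^ M := by positivity
  have hT11 : 1 ≤ T1 := by
    rw [hT1, le_div_iff₀ hq0, one_mul]
    exact mul_le_one₀ (pow_le_one₀ hu0.le (by linarith)) (by positivity)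
      (pow_le_one₀ hu1.le (by linarith))
  have hcu : ((Finset.univ : Finset (Fin N)).card : ℝ) = N := by simp
  have hexb : ξ * (N : ℝ) ^ 2 ≤ ex c p Finset.univ Finset.univ := by
    rw [ex, Finset.sum_sub_distrib, Finset.sum_const, nsmul_eq_mul, hcu, hp, hξ]
    nlinarith
  have hexp : 0 < ex c p Finset.univ Finset.univ := lt_of_lt_of_le (by positivity) hexb
  have hb := book hc (p := p) (A := A) (B := B) (μ := μ) (μ1 := μ1) (δ := δ) (T1 := T1)
    (T := C1 * T1) (E := E) (ρ := ρ) (σ := σ) (n := 57) (m := m) (M := M) (K := k)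
    (by norm_num) (by rw [hp]; norm_num) (by rw [hA]; norm_num) (by rw [hA, hB]; norm_num)
    (by rw [hμ]; norm_num) (by rw [hμ]; norm_num) hμ10 (by rw [hδ]; norm_num)
    (by rw [hA, hB, hμ, hδ]; norm_num) hρ hσ hσ1 hm hmM hM hσm
    (by
      intro S h1 h2
      have := es hc hu0 (by linarith) _ S k M rfl h1 h2
      rw [hT1, le_div_iff₀ hq0]
      rw [add_mul, one_mul] at this
      linarith)
    (by rw [hδ, hp, hC1]; linarith) (by rw [hC1]; linarith) (by rw [hδ, hC1]; linarith)
    (by rw [hE]; positivity)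
    N Finset.univ Finset.univ k k (by simp) le_rfl (hk.mono (Finset.subset_univ _)) hl
    (by
      intro S hS j hj
      have := es hc hρ0 hρ1 _ S j k rfl hj (hl.mono hS)
      rw [hE, le_div_iff₀ (by positivity)]
      have h0 : 0 ≤ ρ ^ j * (1 - ρ) ^ k := by positivity
      rw [add_mul, one_mul, ← mul_assoc] at this
      linarith) hexp
  rw [hcu] at hb
  have hg : ξ * N ≤ ex c p Finset.univ Finset.univ / N := by
    rw [le_div_iff₀ hNp, mul_assoc, ← sq]; exact hexb
  have h1 := pow_le_pow_left₀ (by positivity) hg 60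
  have h2 : (ξ * N) ^ 60 * N * (ρ ^ k * σ ^ k) ≤ (C1 * T1) ^ 3 * E * (N : ℝ) ^ 57 := by
    refine le_trans ?_ hb
    apply mul_le_mul_of_nonneg_right _ (by positivity)
    exact mul_le_mul_of_nonneg_right h1 hNp.le
  have h3 : ξ ^ 60 * (N : ℝ) ^ 4 * (ρ ^ k * σ ^ k) ≤ (C1 * T1) ^ 3 * E := by
    have e : (ξ * N) ^ 60 * N * (ρ ^ k * σ ^ k) = (ξ ^ 60 * (N : ℝ) ^ 4 * (ρ ^ k * σ ^ k)) * (N : ℝ) ^ 57 := by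
      ring
    rw [e] at h2
    exact le_of_mul_le_mul_right h2 (by positivity)
  have h4 : (408 / 100000 : ℝ) ^ k ≤ (u ^ 3 * (ρ * σ * (1 - ρ))) ^ k :=
    pow_le_pow_left₀ (by norm_num) hθ k
  rw [le_div_iff₀ (by positivity), le_div_iff₀ (by positivity)]
  have h5 : (C1 * T1) ^ 3 * E * ((u ^ k) ^ 3 * ((1 - u) ^ M) ^ 3 * (1 - ρ) ^ k) = C1 ^ 3 := by
    rw [hT1, hE]
    field_simp
  have h6 := mul_le_mul_of_nonneg_right h3
    (show 0 ≤ (u ^ k) ^ 3 * ((1 - u) ^ M) ^ 3 * (1 - ρ) ^ k by positivity)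
  rw [h5] at h6
  refine le_trans ?_ h6
  have e2 : ξ ^ 60 * (N : ℝ) ^ 4 * (ρ ^ k * σ ^ k) * ((u ^ k) ^ 3 * ((1 - u) ^ M) ^ 3 * (1 - ρ) ^ k)
    = (N : ℝ) ^ 4 * (u ^ 3 * (ρ * σ * (1 - ρ))) ^ k * ξ ^ 60 * ((1 - u) ^ M) ^ 3 := by
    rw [mul_pow (u ^ 3), mul_pow (ρ * σ), mul_pow ρ, ← pow_mul u 3, ← pow_mul u k, mul_comm 3 k]
    ring
  rw [e2]
  apply mul_le_mul_of_nonneg_right _ (by positivity)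
  apply mul_le_mul_of_nonneg_right _ (by positivity)
  exact mul_le_mul_of_nonneg_left h4 (by positivity)

lemma Free.swap {V : Type*} {c : V → V → Bool} {b : Bool} {k : ℕ} {S : Finset V}
    (h : Free c b k S) : Free (fun v w => !c v w) (!b) k S := by
  intro T hT hcl
  apply h T hT
  intro v hv w hw hvw
  have := hcl v hv w hw hvw
  simpa using this

lemma full_case : ∃ C : ℝ, 0 < C ∧ ∀ (N k : ℕ) (c : Fin N → Fin N → Bool),
    (∀ v w, c v w = c w v) → Free c true k Finset.univ → Free c false k Finset.univ →
    (N : ℝ) ^ 4 * (408 / 100000 : ℝ) ^ k ≤ C := by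
  obtain ⟨C, hC, h⟩ := half_case
  refine ⟨C + 100000 ^ 4, by positivity, ?_⟩
  intro N k c hc hk hl
  rcases lt_or_ge N 100000 with hN | hN
  · have h1 : (N : ℝ) ^ 4 ≤ 100000 ^ 4 :=
      pow_le_pow_left₀ (Nat.cast_nonneg _) (by exact_mod_cast hN.le) 4
    have h2 : (408 / 100000 : ℝ) ^ k ≤ 1 := pow_le_one₀ (by norm_num) (by norm_num)
    have h3 : (N : ℝ) ^ 4 * (408 / 100000 : ℝ) ^ k ≤ 100000 ^ 4 * 1 :=
      mul_le_mul h1 h2 (by positivity) (by positivity)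
    linarith
  suffices (N : ℝ) ^ 4 * (408 / 100000 : ℝ) ^ k ≤ C by
    have : (0:ℝ) < 100000 ^ 4 := by positivity
    linarith
  let c' : Fin N → Fin N → Bool := fun v w => !c v w
  have hnb : ∀ x, nb c' true x Finset.univ = nb c false x Finset.univ := by
    intro x
    ext w
    simp [mem_nb, c']
  have htot : ∑ x : Fin N, ((nb c true x Finset.univ).card : ℝ) +
      ∑ x : Fin N, ((nb c' true x Finset.univ).card : ℝ) = N * (N - 1) := by
    rw [← Finset.sum_add_distrib]
    have : ∀ x ∈ (Finset.univ : Finset (Fin N)), ((nb c true x Finset.univ).card : ℝ) +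
        ((nb c' true x Finset.univ).card : ℝ) = N - 1 := by
      intro x hx
      rw [hnb]
      have h1 := card_split c x Finset.univ hx
      rw [Finset.card_univ, Fintype.card_fin] at h1
      have h2 : ((nb c true x Finset.univ).card : ℝ) + (nb c false x Finset.univ).card + 1 = N := by
        exact_mod_cast h1
      linarith
    rw [Finset.sum_congr rfl this, Finset.sum_const, nsmul_eq_mul]
    simp
  rcases le_or_gt ((N : ℝ) * (N - 1) / 2) (∑ x : Fin N, ((nb c true x Finset.univ).card : ℝ)) with h1 | h1
  · exact h N k c hc hk hl h1 hN
  · exact h N k c' (fun v w => by simp only [c']; rw [hc]) hl.swap hk.swap (by linarith) hN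

lemma free_of_not {N k : ℕ} {c : Fin N → Fin N → Bool} (h : ¬ HasMonoClique N k c) (b : Bool) :
    Free c b k Finset.univ := by
  intro T _ hcl
  by_contra hcon
  push Not at hcon
  obtain ⟨S, hST, hS⟩ := Finset.exists_subset_card_eq hcon
  exact h ⟨S, b, hS, fun v hv w hw => hcl v (hST hv) w (hST hw)⟩

lemma ramsey_bound : ∃ C : ℝ, 0 < C ∧ ∀ k : ℕ,
    (ramsey k : ℝ) ^ 4 * (408 / 100000 : ℝ) ^ k ≤ C := by
  obtain ⟨C, hC, h⟩ := full_case
  refine ⟨16 * C + 1, by positivity, ?_⟩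
  intro k
  have hq1 : (408 / 100000 : ℝ) ^ k ≤ 1 := pow_le_one₀ (by norm_num) (by norm_num)
  have hq0 : (0:ℝ) < (408 / 100000 : ℝ) ^ k := by positivity
  rcases Nat.lt_or_ge (ramsey k) 2 with h2 | h2
  · have : (ramsey k : ℝ) ^ 4 ≤ 1 := by
      apply pow_le_one₀ (Nat.cast_nonneg _)
      exact_mod_cast (by omega : ramsey k ≤ 1)
    have := mul_le_one₀ this hq0.le hq1
    linarith
  have hmem : ramsey k - 1 ∉ {N | ∀ c : Fin N → Fin N → Bool, (∀ v w, c v w = c w v) →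
      HasMonoClique N k c} := by
    apply Nat.notMem_of_lt_sInf
    change ramsey k - 1 < ramsey k
    omega
  rw [Set.mem_ofPred_eq] at hmem
  push Not at hmem
  obtain ⟨c, hc, hno⟩ := hmem
  have h3 := h _ k c hc (free_of_not hno true) (free_of_not hno false)
  have h4 : (ramsey k : ℝ) ≤ 2 * ((ramsey k - 1 : ℕ) : ℝ) := by
    exact_mod_cast (by omega : ramsey k ≤ 2 * (ramsey k - 1))
  have h5 := pow_le_pow_left₀ (Nat.cast_nonneg _) h4 4
  have h6 := mul_le_mul_of_nonneg_right h5 hq0.le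
  rw [mul_pow] at h6
  linarith

end Book

/-- For every `ε > 0` and all sufficiently large `k`,
`r(k) ≤ 2 ^ ((2 - 3/200 + ε) k)`. -/
theorem ramsey_le_two_pow (ε : ℝ) (hε : 0 < ε) :
    ∃ k₀ : ℕ, ∀ k : ℕ, k₀ ≤ k →
      (ramsey k : ℝ) ≤ (2 : ℝ) ^ ((2 - 3 / 200 + ε) * k) := by
  obtain ⟨C, hC, h⟩ := Book.ramsey_bound
  have hb : (1:ℝ) < 2 ^ (4 * ε) := Real.one_lt_rpow (by norm_num) (by positivity)
  obtain ⟨k₀, hk₀⟩ := pow_unbounded_of_one_lt C hb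
  refine ⟨k₀, ?_⟩
  intro k hk
  have h1 : C ≤ ((2:ℝ) ^ (4 * ε)) ^ k := hk₀.le.trans (pow_le_pow_right₀ hb.le hk)
  have h2 : (1:ℝ) ≤ 408 / 100000 * 2 ^ (794 / 100 : ℝ) := by
    have e : (408 / 100000 * (2:ℝ) ^ (794 / 100 : ℝ)) ^ 50 = (408 / 100000) ^ 50 * 2 ^ 397 := by
      rw [mul_pow, ← Real.rpow_natCast ((2:ℝ) ^ (794 / 100 : ℝ)), ← Real.rpow_mul (by norm_num),
        ← Real.rpow_natCast 2 397]
      norm_num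
    by_contra hcon
    push Not at hcon
    have h3 : (408 / 100000 * (2:ℝ) ^ (794 / 100 : ℝ)) ^ 50 < 1 :=
      pow_lt_one₀ (by positivity) hcon (by norm_num)
    rw [e] at h3
    exact absurd h3 (not_lt.2 Book.num_bound)
  have h3 : (1:ℝ) ≤ (408 / 100000) ^ k * (2 ^ (794 / 100 : ℝ)) ^ k := by
    rw [← mul_pow]
    exact one_le_pow₀ h2
  have e : ((2 : ℝ) ^ ((2 - 3 / 200 + ε) * k)) ^ 4 = ((2:ℝ) ^ (4 * ε)) ^ k * (2 ^ (794 / 100 : ℝ)) ^ k := by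
    rw [← Real.rpow_natCast, ← Real.rpow_natCast, ← Real.rpow_natCast, ← Real.rpow_mul (by norm_num),
      ← Real.rpow_mul (by norm_num), ← Real.rpow_mul (by norm_num), ← Real.rpow_add (by norm_num)]
    congr 1
    push_cast
    ring
  refine le_of_pow_le_pow_left₀ (n := 4) (by norm_num) (by positivity) ?_
  rw [e]
  have hP : (0:ℝ) ≤ (2 ^ (794 / 100 : ℝ)) ^ k := by positivity
  calc (ramsey k : ℝ) ^ 4 ≤ (ramsey k : ℝ) ^ 4 * ((408 / 100000) ^ k * (2 ^ (794 / 100 : ℝ)) ^ k) :=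
        le_mul_of_one_le_right (by positivity) h3
    _ = ((ramsey k : ℝ) ^ 4 * (408 / 100000) ^ k) * (2 ^ (794 / 100 : ℝ)) ^ k := by ring
    _ ≤ C * (2 ^ (794 / 100 : ℝ)) ^ k := mul_le_mul_of_nonneg_right (h k) hP
    _ ≤ _ := mul_le_mul_of_nonneg_right h1 hP
end
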